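/- arXiv:2402.02434 — 2 statements merged into one kernel-verified Lean document; each statement's English description precedes it below -/
import Mathlib

section
/- Let 0 < η ≤ 1 and let q₀ : ℤ → ℂ satisfy |q₀(n)| < 1 for all n and ∏_{n=−M}^{M} (1 − |q₀(n)|²) ≥ η for every M ∈ ℕ. Fix N ∈ ℕ and let q₀,N be the truncated datum: q₀,N(n) = q₀(n) for |n| ≤ N and q₀,N(n) = 0 for |n| > N. Let q and q_N solve the Ablowitz–Ladik equation on ℝ with initial data q₀ and q₀,N respectively, both taking values in the open unit disc (|q(s,m)| < 1 and |q_N(s,m)| < 1 for all s, m). Then for every j ∈ ℤ with N ≥ |j|, every t > 0, and every r ∈ (0,1): |q(t,j) − q_N(t,j)| ≤ (4·e^{t/r}·C(η,r)/(1−r)) · r^{N−|j|}. -/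
open Complex Metric Finset Filter

noncomputable section

/-- The constant `C(η, r)`. -/
def Cconst (η r : ℝ) : ℝ :=
  Real.exp (Real.log (1 / η) * (2 + 1 / (1 - Real.sqrt (1 - η))) * (4 / (1 - r) ^ 2 + 1))

/-- The right-hand side of the Ablowitz–Ladik equation:
`i·(1 − |q(t,n)|²)·(q(t,n−1) + q(t,n+1))`. -/
def ALDeriv (q : ℝ → ℤ → ℂ) (t : ℝ) (n : ℤ) : ℂ :=
  Complex.I * ((1 - ‖q t n‖ ^ 2 : ℝ) : ℂ) * (q t (n - 1) + q t (n + 1))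


/-- Finite Schur continued fraction with coefficients `a n, …, a (n+L-1)`. -/
def SF : ℕ → (ℤ → ℂ) → ℤ → ℂ → ℂ
  | 0, _, _, _ => 0
  | L + 1, a, n, z =>
    (a n + z * SF L a (n + 1) z) / (1 + (starRingEnd ℂ) (a n) * (z * SF L a (n + 1) z))

lemma den_ne {a w : ℂ} (ha : ‖a‖ < 1) (hw : ‖w‖ < 1) : 1 + (starRingEnd ℂ) a * w ≠ 0 := by
  intro h
  have h1 : (starRingEnd ℂ) a * w = -1 := by linear_combination h
  have h2 : ‖(starRingEnd ℂ) a * w‖ = 1 := by rw [h1]; simp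
  rw [norm_mul, RCLike.norm_conj] at h2
  nlinarith [norm_nonneg a, norm_nonneg w]

lemma mob_ident (a w : ℂ) :
    ‖1 + (starRingEnd ℂ) a * w‖ ^ 2 - ‖a + w‖ ^ 2 = (1 - ‖a‖ ^ 2) * (1 - ‖w‖ ^ 2) := by
  rw [← Complex.normSq_eq_norm_sq, ← Complex.normSq_eq_norm_sq, ← Complex.normSq_eq_norm_sq,
    ← Complex.normSq_eq_norm_sq]
  simp [Complex.normSq_apply]
  ring

lemma mob_sub {a w : ℂ} (ha : ‖a‖ < 1) (hw : ‖w‖ < 1) :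
    1 - ‖(a + w) / (1 + (starRingEnd ℂ) a * w)‖ ^ 2
      = (1 - ‖a‖ ^ 2) * (1 - ‖w‖ ^ 2) / ‖1 + (starRingEnd ℂ) a * w‖ ^ 2 := by
  have h := den_ne ha hw
  have h' : ‖1 + (starRingEnd ℂ) a * w‖ ≠ 0 := by simpa using h
  rw [← mob_ident, norm_div, div_pow, sub_div, div_self (pow_ne_zero 2 h')]

lemma mob_lt {a w : ℂ} (ha : ‖a‖ < 1) (hw : ‖w‖ < 1) :
    ‖(a + w) / (1 + (starRingEnd ℂ) a * w)‖ < 1 := by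
  have h := mob_sub ha hw
  have h' : 0 < ‖1 + (starRingEnd ℂ) a * w‖ := by simpa using den_ne ha hw
  have : 0 < (1 - ‖a‖ ^ 2) * (1 - ‖w‖ ^ 2) / ‖1 + (starRingEnd ℂ) a * w‖ ^ 2 := by
    have h1 : 0 < 1 - ‖a‖ ^ 2 := by nlinarith [norm_nonneg a]
    have h2 : 0 < 1 - ‖w‖ ^ 2 := by nlinarith [norm_nonneg w]
    positivity
  rw [← h] at this
  nlinarith [norm_nonneg ((a + w) / (1 + (starRingEnd ℂ) a * w))]

lemma mob_le {a w : ℂ} (ha : ‖a‖ < 1) (hw : ‖w‖ < 1) :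
    ‖(a + w) / (1 + (starRingEnd ℂ) a * w)‖ ≤ ‖a‖ + ‖w‖ := by
  have h := mob_sub ha hw
  have h' : 0 < ‖1 + (starRingEnd ℂ) a * w‖ := by simpa using den_ne ha hw
  have h1 : ‖1 + (starRingEnd ℂ) a * w‖ ≤ 1 + ‖a‖ * ‖w‖ := by
    refine (norm_add_le _ _).trans ?_
    simp
  have h2 : (1 - ‖a‖ ^ 2) * (1 - ‖w‖ ^ 2) / (1 + ‖a‖ * ‖w‖) ^ 2
      ≤ (1 - ‖a‖ ^ 2) * (1 - ‖w‖ ^ 2) / ‖1 + (starRingEnd ℂ) a * w‖ ^ 2 := by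
    have h1' : 0 ≤ 1 - ‖a‖ ^ 2 := by nlinarith [norm_nonneg a]
    have h2' : 0 ≤ 1 - ‖w‖ ^ 2 := by nlinarith [norm_nonneg w]
    gcongr
  have hp : 0 ≤ ‖a‖ * ‖w‖ := by positivity
  have h3 : 1 - (‖a‖ + ‖w‖) ^ 2 ≤ (1 - ‖a‖ ^ 2) * (1 - ‖w‖ ^ 2) / (1 + ‖a‖ * ‖w‖) ^ 2 := by
    rw [le_div_iff₀ (by positivity)]
    have : (1 - ‖a‖ ^ 2) * (1 - ‖w‖ ^ 2) = (1 + ‖a‖ * ‖w‖) ^ 2 - (‖a‖ + ‖w‖) ^ 2 := by ring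
    rw [this]
    have h4 : (1:ℝ) ≤ (1 + ‖a‖ * ‖w‖) ^ 2 := by nlinarith
    nlinarith [mul_nonneg (sq_nonneg (‖a‖ + ‖w‖)) (sub_nonneg.2 h4)]
  have : ‖(a + w) / (1 + (starRingEnd ℂ) a * w)‖ ^ 2 ≤ (‖a‖ + ‖w‖) ^ 2 := by linarith
  exact le_of_sq_le_sq this (by positivity)

lemma SF_lt {a : ℤ → ℂ} (ha : ∀ n, ‖a n‖ < 1) (L : ℕ) :
    ∀ (n : ℤ) (z : ℂ), ‖z‖ ≤ 1 → ‖SF L a n z‖ < 1 := by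
  induction L with
  | zero => intro n z _; simp [SF]
  | succ L ih =>
    intro n z hz
    refine mob_lt (ha n) ?_
    rw [norm_mul]
    nlinarith [ih (n + 1) z hz, norm_nonneg (SF L a (n + 1) z), norm_nonneg z]

lemma zSF_lt {a : ℤ → ℂ} (ha : ∀ n, ‖a n‖ < 1) (L : ℕ) (n : ℤ) (z : ℂ) (hz : ‖z‖ ≤ 1) :
    ‖z * SF L a n z‖ < 1 := by
  rw [norm_mul]
  nlinarith [SF_lt ha L n z hz, norm_nonneg (SF L a n z), norm_nonneg z]

lemma SF_diff {a : ℤ → ℂ} (ha : ∀ n, ‖a n‖ < 1) (L : ℕ) :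
    ∀ (n : ℤ) (z : ℂ), ‖z‖ ≤ 1 → DifferentiableAt ℂ (SF L a n) z := by
  induction L with
  | zero => intro n z _; exact differentiableAt_const (0:ℂ)
  | succ L ih =>
    intro n z hz
    have h1 := ih (n + 1) z hz
    have h2 := den_ne (ha n) (zSF_lt ha L (n + 1) z hz)
    show DifferentiableAt ℂ (fun z => (a n + z * SF L a (n + 1) z) /
      (1 + (starRingEnd ℂ) (a n) * (z * SF L a (n + 1) z))) z
    fun_prop (disch := assumption)

lemma SF_zero (L : ℕ) (a : ℤ → ℂ) (n : ℤ) : SF (L + 1) a n 0 = a n := by simp [SF]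

lemma SF_one (a : ℤ → ℂ) (n : ℤ) (z : ℂ) : SF 1 a n z = a n := by simp [SF]

/-- The quotient `(SF a - SF b) / z^K` -/
def QF : ℕ → ℕ → (ℤ → ℂ) → (ℤ → ℂ) → ℤ → ℂ → ℂ
  | 0, L, a, b, n, z => SF L a n z - SF L b n z
  | K + 1, L, a, b, n, z =>
    (1 - (‖a n‖ : ℂ) ^ 2) * QF K L a b (n + 1) z /
      ((1 + (starRingEnd ℂ) (a n) * (z * SF (K + L) a (n + 1) z)) *
        (1 + (starRingEnd ℂ) (b n) * (z * SF (K + L) b (n + 1) z)))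

lemma QF_eq {a b : ℤ → ℂ} (ha : ∀ n, ‖a n‖ < 1) (hb : ∀ n, ‖b n‖ < 1) (K L : ℕ) :
    ∀ (n : ℤ), (∀ k : ℤ, n ≤ k → k < n + K → a k = b k) → ∀ z : ℂ, ‖z‖ ≤ 1 →
    SF (K + L) a n z - SF (K + L) b n z = z ^ K * QF K L a b n z := by
  induction K with
  | zero => intro n _ z _; simp [QF]
  | succ K ih =>
    intro n hab z hz
    have h := ih (n + 1) (fun k h1 h2 => hab k (by omega) (by push_cast; omega)) z hz
    have hn : b n = a n := (hab n le_rfl (by push_cast; omega)).symm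
    have e : K + 1 + L = (K + L) + 1 := by ring
    have h1 := den_ne (ha n) (zSF_lt ha (K + L) (n + 1) z hz)
    have h2 := den_ne (hb n) (zSF_lt hb (K + L) (n + 1) z hz)
    rw [e]
    simp only [SF, QF]
    rw [hn] at h2 ⊢
    have h3 : (‖a n‖ : ℂ) ^ 2 = (starRingEnd ℂ) (a n) * a n := by
      rw [Complex.conj_mul']
    rw [div_sub_div _ _ h1 h2, mul_div_assoc', h3]
    congr 1
    rw [pow_succ]
    linear_combination (z * (1 - (starRingEnd ℂ) (a n) * a n)) * h

lemma QF_diff {a b : ℤ → ℂ} (ha : ∀ n, ‖a n‖ < 1) (hb : ∀ n, ‖b n‖ < 1) (K L : ℕ) :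
    ∀ (n : ℤ) (z : ℂ), ‖z‖ ≤ 1 → DifferentiableAt ℂ (QF K L a b n) z := by
  induction K with
  | zero => intro n z hz; exact (SF_diff ha L n z hz).sub (SF_diff hb L n z hz)
  | succ K ih =>
    intro n z hz
    have h0 := ih (n + 1) z hz
    have h1 := den_ne (ha n) (zSF_lt ha (K + L) (n + 1) z hz)
    have h2 := den_ne (hb n) (zSF_lt hb (K + L) (n + 1) z hz)
    have h3 := SF_diff ha (K + L) (n + 1) z hz
    have h4 := SF_diff hb (K + L) (n + 1) z hz
    have h5 := mul_ne_zero h1 h2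
    show DifferentiableAt ℂ (fun z => (1 - (‖a n‖ : ℂ) ^ 2) * QF K L a b (n + 1) z /
      ((1 + (starRingEnd ℂ) (a n) * (z * SF (K + L) a (n + 1) z)) *
        (1 + (starRingEnd ℂ) (b n) * (z * SF (K + L) b (n + 1) z)))) z
    fun_prop (disch := assumption)

lemma SF_close {a b : ℤ → ℂ} (ha : ∀ n, ‖a n‖ < 1) (hb : ∀ n, ‖b n‖ < 1) (K L : ℕ)
    (n : ℤ) (hab : ∀ k : ℤ, n ≤ k → k < n + K → a k = b k) (z : ℂ) (hz : ‖z‖ ≤ 1) :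
    ‖SF (K + L) a n z - SF (K + L) b n z‖ ≤ 2 * ‖z‖ ^ K := by
  have key : ‖QF K L a b n z‖ ≤ 2 := by
    refine Complex.norm_le_of_forall_mem_frontier_norm_le (U := ball (0:ℂ) 1)
      isBounded_ball ?_ ?_ ?_
    · refine DifferentiableOn.diffContOnCl ?_
      intro w hw
      rw [closure_ball _ one_ne_zero] at hw
      exact (QF_diff ha hb K L n w (by simpa using hw)).differentiableWithinAt
    · intro w hw
      rw [frontier_ball _ one_ne_zero] at hw
      have hw1 : ‖w‖ = 1 := by simpa using hw
      have h := QF_eq ha hb K L n hab w hw1.le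
      have h2 : ‖QF K L a b n w‖ = ‖SF (K + L) a n w - SF (K + L) b n w‖ := by
        rw [h, norm_mul, norm_pow, hw1]; simp
      rw [h2]
      refine (norm_sub_le _ _).trans ?_
      linarith [SF_lt ha (K + L) n w hw1.le, SF_lt hb (K + L) n w hw1.le]
    · rw [closure_ball _ one_ne_zero]; simpa using hz
  rw [QF_eq ha hb K L n hab z hz, norm_mul, norm_pow, mul_comm]
  gcongr

/-- majorant of `|SF L a n z|` on `|z| = r` -/
def XB (r : ℝ) : ℕ → (ℤ → ℂ) → ℤ → ℝ
  | 0, _, _ => 0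
  | L + 1, a, n => ‖a n‖ + r * XB r L a (n + 1)

/-- sum of squares of the majorants -/
def QB (r : ℝ) : ℕ → (ℤ → ℂ) → ℤ → ℝ
  | 0, _, _ => 0
  | L + 1, a, n => XB r (L + 1) a n ^ 2 + QB r L a (n + 1)

/-- sum of squares of the coefficients -/
def AB : ℕ → (ℤ → ℂ) → ℤ → ℝ
  | 0, _, _ => 0
  | L + 1, a, n => ‖a n‖ ^ 2 + AB L a (n + 1)

lemma XB_nonneg {r : ℝ} (hr : 0 ≤ r) (L : ℕ) (a : ℤ → ℂ) : ∀ n, 0 ≤ XB r L a n := by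
  induction L with
  | zero => intro n; simp [XB]
  | succ L ih => intro n; have := ih (n + 1); simp only [XB]; positivity

lemma SF_le_XB {a : ℤ → ℂ} (ha : ∀ n, ‖a n‖ < 1) {r : ℝ} (hr1 : r < 1)
    {z : ℂ} (hz : ‖z‖ = r) (L : ℕ) : ∀ n, ‖SF L a n z‖ ≤ XB r L a n := by
  induction L with
  | zero => intro n; simp [SF, XB]
  | succ L ih =>
    intro n
    have hz1 : ‖z‖ ≤ 1 := by linarith
    refine (mob_le (ha n) (zSF_lt ha L (n + 1) z hz1)).trans ?_
    rw [norm_mul, hz]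
    have : 0 ≤ r := hz ▸ norm_nonneg z
    simp only [XB]
    gcongr
    exact ih _

lemma QB_le (r : ℝ) (hr : 0 < r) (hr1 : r < 1) (L : ℕ) (a : ℤ → ℂ) :
    ∀ n, (1 - r) * QB r L a n + r * XB r L a n ^ 2 ≤ AB L a n / (1 - r) := by
  have h1 : 0 < 1 - r := by linarith
  induction L with
  | zero => intro n; simp [QB, XB, AB]
  | succ L ih =>
    intro n
    have h := ih (n + 1)
    rw [le_div_iff₀ h1] at h ⊢
    simp only [QB, AB]
    have hx : XB r (L + 1) a n = ‖a n‖ + r * XB r L a (n + 1) := rfl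
    rw [hx]
    set x := XB r L a (n + 1)
    set y := ‖a n‖
    have : (1 - r) * (y + r * x) ^ 2 ≤ y ^ 2 + r * (1 - r) * x ^ 2 := by
      nlinarith [mul_nonneg hr.le (sq_nonneg (y - (1 - r) * x))]
    nlinarith

/-- accumulated exponent -/
def GB (r τ : ℝ) : ℕ → (ℤ → ℂ) → (ℤ → ℂ) → ℤ → ℝ
  | 0, _, _, _ => 0
  | L + 1, a, b, n =>
    (τ * (‖a n‖ * XB r (L + 1) a n + ‖b n‖ * XB r (L + 1) b n)
      + (XB r (L + 1) a n * XB r (L + 1) b n + 2 * ‖b n‖ * XB r (L + 1) b n + ‖a n‖ * ‖b n‖))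
      + GB r τ L a b (n + 1)

lemma GB_nonneg {r τ : ℝ} (hr : 0 ≤ r) (hτ : 0 ≤ τ) (L : ℕ) (a b : ℤ → ℂ) :
    ∀ n, 0 ≤ GB r τ L a b n := by
  induction L with
  | zero => intro n; simp [GB]
  | succ L ih =>
    intro n
    have := ih (n + 1)
    have h1 := XB_nonneg hr (L + 1) a n
    have h2 := XB_nonneg hr (L + 1) b n
    simp only [GB]; positivity

lemma GB_le {r τ : ℝ} (hτ : 0 ≤ τ) (L : ℕ) (a b : ℤ → ℂ) :
    ∀ n, GB r τ L a b n ≤ τ * ((AB L a n + QB r L a n) / 2 + (AB L b n + QB r L b n) / 2)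
      + ((QB r L a n + QB r L b n) / 2 + (AB L b n + QB r L b n) + (AB L a n + AB L b n) / 2) := by
  induction L with
  | zero => intro n; simp [GB, AB, QB]
  | succ L ih =>
    intro n
    have h := ih (n + 1)
    simp only [GB, AB, QB]
    set x := XB r (L + 1) a n
    set y := XB r (L + 1) b n
    have e1 : ‖a n‖ * x + ‖b n‖ * y ≤ (‖a n‖ ^ 2 + x ^ 2) / 2 + (‖b n‖ ^ 2 + y ^ 2) / 2 := by
      nlinarith [sq_nonneg (‖a n‖ - x), sq_nonneg (‖b n‖ - y)]
    have e2 := mul_le_mul_of_nonneg_left e1 hτ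
    nlinarith [sq_nonneg (x - y), sq_nonneg (‖b n‖ - y), sq_nonneg (‖a n‖ - ‖b n‖)]

lemma GB_final {r τ S : ℝ} (hτ : 0 ≤ τ) (hr : 0 < r) (hr1 : r < 1) (L : ℕ) (a b : ℤ → ℂ) (n : ℤ)
    (ha : AB L a n ≤ S) (hb : AB L b n ≤ S) (hS : 0 ≤ S) :
    GB r τ L a b n ≤ S * (2 + τ) * (4 / (1 - r) ^ 2 + 1) := by
  have h1 : 0 < 1 - r := by linarith
  have Q : ∀ c : ℤ → ℂ, AB L c n ≤ S → QB r L c n ≤ S * (1 / (1 - r) ^ 2) := by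
    intro c hc
    have h := QB_le r hr hr1 L c n
    have : (1 - r) * QB r L c n ≤ S / (1 - r) := by
      have h2 : AB L c n / (1 - r) ≤ S / (1 - r) := by gcongr
      nlinarith [mul_nonneg hr.le (sq_nonneg (XB r L c n))]
    rw [← mul_div_assoc, mul_one, le_div_iff₀ (by positivity)]
    rw [le_div_iff₀ h1] at this
    nlinarith
  have qa := Q a ha
  have qb := Q b hb
  have h := GB_le (r := r) hτ L a b n
  have h4 : 4 / (1 - r) ^ 2 = 4 * (1 / (1 - r) ^ 2) := by ring
  rw [h4]
  have hρ : 0 ≤ 1 / (1 - r) ^ 2 := by positivity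
  set ρ := 1 / (1 - r) ^ 2
  have e : (AB L a n + QB r L a n) / 2 + (AB L b n + QB r L b n) / 2 ≤ S + S * ρ := by linarith
  have e2 := mul_le_mul_of_nonneg_left e hτ
  have : 0 ≤ S * ρ := by positivity
  have : 0 ≤ τ * (S * ρ) := by positivity
  nlinarith

lemma conv_sq (x y w k1 k2 : ℝ) (h1 : 0 ≤ k1) (h2 : 0 ≤ k2) :
    (x + k1 * y + k2 * w) ^ 2 ≤ (1 + k1 + k2) * (x ^ 2 + k1 * y ^ 2 + k2 * w ^ 2) := by
  nlinarith [mul_nonneg h1 (sq_nonneg (x - y)), mul_nonneg h2 (sq_nonneg (x - w)),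
    mul_nonneg (mul_nonneg h1 h2) (sq_nonneg (y - w))]

lemma one_div_le_exp {α f : ℂ} {x c : ℝ} (ha : ‖α‖ ≤ c) (hc : c < 1) (hf : ‖f‖ ≤ 1)
    (hx : ‖f‖ ≤ x) :
    1 ≤ Real.exp (1 / (1 - c) * (‖α‖ * x)) * ‖1 - (starRingEnd ℂ) α * f‖ := by
  set y := ‖α‖ * ‖f‖ with hy
  have hy0 : 0 ≤ y := by positivity
  have hyc : y ≤ c := by
    calc y ≤ ‖α‖ * 1 := by rw [hy]; gcongr
      _ ≤ c := by linarith
  have h1 : 1 - y ≤ ‖1 - (starRingEnd ℂ) α * f‖ := by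
    have := norm_sub_norm_le (1:ℂ) ((starRingEnd ℂ) α * f)
    simpa [hy] using this
  have hc1 : 0 < 1 - c := by linarith
  have h2 : 1 / (1 - c) * y ≤ 1 / (1 - c) * (‖α‖ * x) := by
    rw [hy]; gcongr
  have h3 : 1 + 1 / (1 - c) * y ≤ Real.exp (1 / (1 - c) * (‖α‖ * x)) := by
    linarith [Real.add_one_le_exp (1 / (1 - c) * (‖α‖ * x))]
  have h4 : 1 ≤ (1 + 1 / (1 - c) * y) * (1 - y) := by
    have : y ≤ 1 / (1 - c) * y * (1 - y) := by
      have h5 : 1 ≤ 1 / (1 - c) * (1 - y) := by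
        rw [one_div, inv_mul_eq_div, le_div_iff₀ hc1]; linarith
      nlinarith
    nlinarith
  calc 1 ≤ (1 + 1 / (1 - c) * y) * (1 - y) := h4
    _ ≤ _ := by
      apply mul_le_mul h3 h1 (by linarith) (by positivity)

/-- algebra of one Schur step -/
lemma step_alg {a b f g : ℂ} (h1 : 1 - (starRingEnd ℂ) a * f ≠ 0)
    (h2 : 1 - (starRingEnd ℂ) b * g ≠ 0) :
    ((f - a) / (1 - (starRingEnd ℂ) a * f) - (g - b) / (1 - (starRingEnd ℂ) b * g)) *
      ((1 - (starRingEnd ℂ) a * f) * (1 - (starRingEnd ℂ) b * g))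
    = ((f - g) - (a - b)) + (((starRingEnd ℂ) (a - b)) * (f * g) + (a - b) * ((starRingEnd ℂ) b * g)
      - (starRingEnd ℂ) (a - b) * (b * g) - (starRingEnd ℂ) a * b * (f - g)) := by
  rw [div_sub_div _ _ h1 h2, div_mul_cancel₀ _ (mul_ne_zero h1 h2), map_sub]
  ring

lemma step_pt {a b f g : ℂ} {x y c : ℝ} (ha : ‖a‖ ≤ c) (hb : ‖b‖ ≤ c) (hc : c < 1)
    (hf : ‖f‖ ≤ 1) (hg : ‖g‖ ≤ 1) (hx : ‖f‖ ≤ x) (hy : ‖g‖ ≤ y) :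
    ‖(f - a) / (1 - (starRingEnd ℂ) a * f) - (g - b) / (1 - (starRingEnd ℂ) b * g)‖ ^ 2
      ≤ Real.exp (2 * (1 / (1 - c) * (‖a‖ * x + ‖b‖ * y))) *
        ((1 + (x * y + 2 * ‖b‖ * y) + ‖a‖ * ‖b‖) *
        (‖(f - g) - (a - b)‖ ^ 2 + (x * y + 2 * ‖b‖ * y) * ‖a - b‖ ^ 2
          + (‖a‖ * ‖b‖) * ‖f - g‖ ^ 2)) := by
  have hx0 : 0 ≤ x := (norm_nonneg _).trans hx
  have hy0 : 0 ≤ y := (norm_nonneg _).trans hy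
  have e1 := one_div_le_exp ha hc hf hx
  have e2 := one_div_le_exp hb hc hg hy
  have n1 : 1 - (starRingEnd ℂ) a * f ≠ 0 := by
    intro h; rw [h] at e1; simp at e1; linarith
  have n2 : 1 - (starRingEnd ℂ) b * g ≠ 0 := by
    intro h; rw [h] at e2; simp at e2; linarith
  have key := step_alg n1 n2
  set W := (f - a) / (1 - (starRingEnd ℂ) a * f) - (g - b) / (1 - (starRingEnd ℂ) b * g)
  set D1 := 1 - (starRingEnd ℂ) a * f
  set D2 := 1 - (starRingEnd ℂ) b * g
  have hnum : ‖W * (D1 * D2)‖ ≤ ‖(f - g) - (a - b)‖ + (x * y + 2 * ‖b‖ * y) * ‖a - b‖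
      + (‖a‖ * ‖b‖) * ‖f - g‖ := by
    rw [key]
    have t1 : ‖(starRingEnd ℂ) (a - b) * (f * g)‖ ≤ ‖a - b‖ * (x * y) := by
      rw [norm_mul, RCLike.norm_conj, norm_mul]; gcongr
    have t2 : ‖(a - b) * ((starRingEnd ℂ) b * g)‖ ≤ ‖a - b‖ * (‖b‖ * y) := by
      rw [norm_mul, norm_mul, RCLike.norm_conj]; gcongr
    have t3 : ‖(starRingEnd ℂ) (a - b) * (b * g)‖ ≤ ‖a - b‖ * (‖b‖ * y) := by
      rw [norm_mul, RCLike.norm_conj, norm_mul]; gcongr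
    have t4 : ‖(starRingEnd ℂ) a * b * (f - g)‖ = ‖a‖ * ‖b‖ * ‖f - g‖ := by
      rw [norm_mul, norm_mul, RCLike.norm_conj]
    refine (norm_add_le _ _).trans ?_
    have := norm_sub_le ((starRingEnd ℂ) (a - b) * (f * g) + (a - b) * ((starRingEnd ℂ) b * g)
      - (starRingEnd ℂ) (a - b) * (b * g)) ((starRingEnd ℂ) a * b * (f - g))
    have := norm_sub_le ((starRingEnd ℂ) (a - b) * (f * g) + (a - b) * ((starRingEnd ℂ) b * g))
      ((starRingEnd ℂ) (a - b) * (b * g))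
    have := norm_add_le ((starRingEnd ℂ) (a - b) * (f * g)) ((a - b) * ((starRingEnd ℂ) b * g))
    nlinarith
  have hW : ‖W‖ ≤ Real.exp (1 / (1 - c) * (‖a‖ * x + ‖b‖ * y)) * ‖W * (D1 * D2)‖ := by
    rw [norm_mul, norm_mul, mul_add, Real.exp_add]
    have : 1 ≤ (Real.exp (1 / (1 - c) * (‖a‖ * x)) * ‖D1‖) *
      (Real.exp (1 / (1 - c) * (‖b‖ * y)) * ‖D2‖) := by nlinarith
    nlinarith [mul_le_mul_of_nonneg_left this (norm_nonneg W)]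
  have hk1 : 0 ≤ x * y + 2 * ‖b‖ * y := by positivity
  have hk2 : 0 ≤ ‖a‖ * ‖b‖ := by positivity
  calc ‖W‖ ^ 2 ≤ (Real.exp (1 / (1 - c) * (‖a‖ * x + ‖b‖ * y)) * ‖W * (D1 * D2)‖) ^ 2 := by gcongr
    _ = Real.exp (2 * (1 / (1 - c) * (‖a‖ * x + ‖b‖ * y))) * ‖W * (D1 * D2)‖ ^ 2 := by
      rw [mul_pow, ← Real.exp_nat_mul]; norm_num
    _ ≤ _ := by
      gcongr
      refine le_trans ?_ (conv_sq _ _ _ _ _ hk1 hk2)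
      gcongr

/-- mean of `|f-g|^2` over the circle of radius `r` -/
def ND (r : ℝ) (L : ℕ) (a b : ℤ → ℂ) (n : ℤ) : ℝ :=
  Real.circleAverage (fun z => ‖SF L a n z - SF L b n z‖ ^ 2) 0 r

lemma SF_cont {a : ℤ → ℂ} (ha : ∀ n, ‖a n‖ < 1) (L : ℕ) (n : ℤ) {r : ℝ} (hr : 0 < r) (hr1 : r < 1) :
    ContinuousOn (SF L a n) (sphere 0 |r|) := by
  intro z hz
  refine (SF_diff ha L n z ?_).continuousAt.continuousWithinAt
  rw [abs_of_pos hr] at hz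
  simp at hz; linarith

lemma ND_sub {a b : ℤ → ℂ} (ha : ∀ n, ‖a n‖ < 1) (hb : ∀ n, ‖b n‖ < 1) {r : ℝ} (hr : 0 < r)
    (hr1 : r < 1) (L : ℕ) (n : ℤ) :
    Real.circleAverage (fun z => ‖(SF (L + 1) a n z - SF (L + 1) b n z) - (a n - b n)‖ ^ 2) 0 r
      = ND r (L + 1) a b n - ‖a n - b n‖ ^ 2 := by
  have hc := (SF_cont ha (L + 1) n hr hr1).sub (SF_cont hb (L + 1) n hr hr1)
  have hmean : Real.circleAverage (fun z => SF (L + 1) a n z - SF (L + 1) b n z) 0 r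
      = a n - b n := by
    have : DiffContOnCl ℂ (fun z => SF (L + 1) a n z - SF (L + 1) b n z) (ball 0 |r|) := by
      refine DifferentiableOn.diffContOnCl ?_
      intro w hw
      rw [abs_of_pos hr, closure_ball _ hr.ne'] at hw
      have hw' : ‖w‖ ≤ 1 := by simp at hw; linarith
      exact ((SF_diff ha (L + 1) n w hw').sub
        (SF_diff hb (L + 1) n w hw')).differentiableWithinAt
    rw [this.circleAverage, SF_zero, SF_zero]
  set h : ℂ → ℂ := fun z => SF (L + 1) a n z - SF (L + 1) b n z with hh
  set d := a n - b n with hd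
  let ℓ : ℂ →L[ℝ] ℝ := Complex.reCLM.comp
    ((ContinuousLinearMap.mul ℝ ℂ) ((starRingEnd ℂ) d))
  have hℓ : ∀ w, ℓ w = ((starRingEnd ℂ) d * w).re := fun w => rfl
  have hcint : CircleIntegrable h 0 r := hc.circleIntegrable'
  have h1 := ℓ.circleAverage_comp_comm hcint
  have e : (fun z => ‖h z - d‖ ^ 2) = fun z => (‖h z‖ ^ 2 + (-2 : ℝ) • ((ℓ ∘ h) z)) + ‖d‖ ^ 2 := by
    funext z
    simp only [Function.comp, hℓ, smul_eq_mul]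
    rw [← Complex.normSq_eq_norm_sq, ← Complex.normSq_eq_norm_sq, ← Complex.normSq_eq_norm_sq]
    simp [Complex.normSq_apply]; ring
  have i1 : CircleIntegrable (fun z => ‖h z‖ ^ 2) 0 r := (hc.norm.pow 2).circleIntegrable'
  have i2 : CircleIntegrable (ℓ ∘ h) 0 r := (ℓ.continuous.comp_continuousOn hc).circleIntegrable'
  have i3 : CircleIntegrable (fun z => (-2 : ℝ) • ((ℓ ∘ h) z)) 0 r :=
    ((ℓ.continuous.comp_continuousOn hc).const_smul (-2:ℝ)).circleIntegrable'
  have i4 : CircleIntegrable (fun z => ‖h z‖ ^ 2 + (-2 : ℝ) • ((ℓ ∘ h) z)) 0 r := i1.add i3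
  rw [e, Real.circleAverage_fun_add i4 (circleIntegrable_const _ _ _), Real.circleAverage_fun_add i1 i3,
    Real.circleAverage_fun_smul, h1, hmean, Real.circleAverage_const, hℓ]
  have : ((starRingEnd ℂ) d * d).re = ‖d‖ ^ 2 := by
    rw [Complex.conj_mul', ← Complex.ofReal_pow, Complex.ofReal_re]
  rw [this]
  simp only [ND, smul_eq_mul]; ring

lemma SF_inv {a : ℤ → ℂ} (ha : ∀ n, ‖a n‖ < 1) (L : ℕ) (n : ℤ) (z : ℂ) (hz : ‖z‖ ≤ 1) :
    (SF (L + 1) a n z - a n) / (1 - (starRingEnd ℂ) (a n) * SF (L + 1) a n z)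
      = z * SF L a (n + 1) z := by
  have h1 := den_ne (ha n) (zSF_lt ha L (n + 1) z hz)
  have h2 : (1 : ℂ) - (starRingEnd ℂ) (a n) * a n ≠ 0 := by
    rw [Complex.conj_mul', ← Complex.ofReal_pow]
    have : (1:ℝ) - ‖a n‖ ^ 2 ≠ 0 := by nlinarith [ha n, norm_nonneg (a n)]
    exact_mod_cast this
  simp only [SF]
  set w := z * SF L a (n + 1) z
  set α := (starRingEnd ℂ) (a n)
  have h3 : 1 - α * ((a n + w) / (1 + α * w)) = (1 - α * a n) / (1 + α * w) := by
    rw [eq_div_iff h1, sub_mul, mul_assoc, div_mul_cancel₀ _ h1]; ring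
  have h4 : (a n + w) / (1 + α * w) - a n = (w * (1 - α * a n)) / (1 + α * w) := by
    rw [eq_div_iff h1, sub_mul, div_mul_cancel₀ _ h1]; ring
  rw [h3, h4, div_div_div_cancel_right₀ h1, mul_div_cancel_right₀ _ h2]

lemma ND_step {a b : ℤ → ℂ} {c : ℝ} (hc : c < 1) (ha : ∀ n, ‖a n‖ ≤ c) (hb : ∀ n, ‖b n‖ ≤ c)
    {r : ℝ} (hr : 0 < r) (hr1 : r < 1) (L : ℕ) (n : ℤ) :
    r ^ 2 * ND r L a b (n + 1) ≤
      Real.exp (2 * (1 / (1 - c) * (‖a n‖ * XB r (L + 1) a n + ‖b n‖ * XB r (L + 1) b n)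
      + (XB r (L + 1) a n * XB r (L + 1) b n + 2 * ‖b n‖ * XB r (L + 1) b n + ‖a n‖ * ‖b n‖)))
      * ND r (L + 1) a b n := by
  have ha1 : ∀ n, ‖a n‖ < 1 := fun n => (ha n).trans_lt hc
  have hb1 : ∀ n, ‖b n‖ < 1 := fun n => (hb n).trans_lt hc
  have hX := XB_nonneg hr.le (L + 1) a n
  have hY := XB_nonneg hr.le (L + 1) b n
  have hpt : ∀ z ∈ sphere (0:ℂ) |r|, ‖SF L a (n + 1) z - SF L b (n + 1) z‖ ^ 2 * r ^ 2 ≤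
      Real.exp (2 * (1 / (1 - c) * (‖a n‖ * XB r (L + 1) a n + ‖b n‖ * XB r (L + 1) b n))) *
        ((1 + (XB r (L + 1) a n * XB r (L + 1) b n + 2 * ‖b n‖ * XB r (L + 1) b n) + ‖a n‖ * ‖b n‖) *
        (‖(SF (L + 1) a n z - SF (L + 1) b n z) - (a n - b n)‖ ^ 2
          + (XB r (L + 1) a n * XB r (L + 1) b n + 2 * ‖b n‖ * XB r (L + 1) b n) * ‖a n - b n‖ ^ 2
          + (‖a n‖ * ‖b n‖) * ‖SF (L + 1) a n z - SF (L + 1) b n z‖ ^ 2)) := by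
    intro z hz
    have hz' : ‖z‖ = r := by rw [abs_of_pos hr] at hz; simpa using hz
    have hz1 : ‖z‖ ≤ 1 := by linarith
    have h := step_pt (ha n) (hb n) hc (SF_lt ha1 (L + 1) n z hz1).le (SF_lt hb1 (L + 1) n z hz1).le
      (SF_le_XB ha1 hr1 hz' (L + 1) n) (SF_le_XB hb1 hr1 hz' (L + 1) n)
    rw [SF_inv ha1 L n z hz1, SF_inv hb1 L n z hz1, ← mul_sub, norm_mul, hz', mul_pow,
      mul_comm (r ^ 2)] at h
    exact h
  set X := XB r (L + 1) a n
  set Y := XB r (L + 1) b n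
  set k1 := X * Y + 2 * ‖b n‖ * Y with hk1d
  set k2 := ‖a n‖ * ‖b n‖ with hk2d
  have hk1 : 0 ≤ k1 := by positivity
  have hk2 : 0 ≤ k2 := by positivity
  have hcont := (SF_cont ha1 (L + 1) n hr hr1).sub (SF_cont hb1 (L + 1) n hr hr1)
  have hcont0 := (SF_cont ha1 L (n + 1) hr hr1).sub (SF_cont hb1 L (n + 1) hr hr1)
  have i1 : CircleIntegrable (fun z => ‖(SF (L + 1) a n z - SF (L + 1) b n z) - (a n - b n)‖ ^ 2) 0 r :=
    ((hcont.sub continuousOn_const).norm.pow 2).circleIntegrable'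
  have i2 : CircleIntegrable (fun z => ‖SF (L + 1) a n z - SF (L + 1) b n z‖ ^ 2) 0 r :=
    (hcont.norm.pow 2).circleIntegrable'
  have i3 : CircleIntegrable (fun z => ‖SF L a (n + 1) z - SF L b (n + 1) z‖ ^ 2) 0 r :=
    (hcont0.norm.pow 2).circleIntegrable'
  set A := Real.exp (2 * (1 / (1 - c) * (‖a n‖ * X + ‖b n‖ * Y))) with hA
  have e1 : (fun z => ‖SF L a (n + 1) z - SF L b (n + 1) z‖ ^ 2 * r ^ 2) =
    fun z => (r ^ 2) • (‖SF L a (n + 1) z - SF L b (n + 1) z‖ ^ 2) := by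
    funext z; simp [mul_comm]
  have e2 : (fun z => A * ((1 + k1 + k2) *
        (‖(SF (L + 1) a n z - SF (L + 1) b n z) - (a n - b n)‖ ^ 2 + k1 * ‖a n - b n‖ ^ 2
          + k2 * ‖SF (L + 1) a n z - SF (L + 1) b n z‖ ^ 2))) =
     fun z => (A * (1 + k1 + k2)) •
        ((‖(SF (L + 1) a n z - SF (L + 1) b n z) - (a n - b n)‖ ^ 2 + k1 * ‖a n - b n‖ ^ 2)
          + k2 • ‖SF (L + 1) a n z - SF (L + 1) b n z‖ ^ 2) := by
    funext z; simp [mul_assoc]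
  have i4 : CircleIntegrable (fun z => ‖(SF (L + 1) a n z - SF (L + 1) b n z) - (a n - b n)‖ ^ 2
    + k1 * ‖a n - b n‖ ^ 2) 0 r := i1.add (circleIntegrable_const _ _ _)
  have i5 : CircleIntegrable (fun z => k2 • ‖SF (L + 1) a n z - SF (L + 1) b n z‖ ^ 2) 0 r :=
    ((hcont.norm.pow 2).const_smul k2).circleIntegrable'
  have hmono := Real.circleAverage_mono (c := 0) (R := r)
    (f₁ := fun z => ‖SF L a (n + 1) z - SF L b (n + 1) z‖ ^ 2 * r ^ 2)
    (f₂ := fun z => A * ((1 + k1 + k2) *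
        (‖(SF (L + 1) a n z - SF (L + 1) b n z) - (a n - b n)‖ ^ 2 + k1 * ‖a n - b n‖ ^ 2
          + k2 * ‖SF (L + 1) a n z - SF (L + 1) b n z‖ ^ 2)))
    ((hcont0.norm.pow 2).mul continuousOn_const).circleIntegrable'
    (continuousOn_const.mul (continuousOn_const.mul
      ((((hcont.sub continuousOn_const).norm.pow 2).add continuousOn_const).add
        (continuousOn_const.mul (hcont.norm.pow 2))))).circleIntegrable' hpt
  rw [e1, e2, Real.circleAverage_fun_smul, Real.circleAverage_fun_smul, Real.circleAverage_fun_add i4 i5,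
    Real.circleAverage_fun_add i1 (circleIntegrable_const _ _ _), Real.circleAverage_const,
    Real.circleAverage_fun_smul, ND_sub ha1 hb1 hr hr1] at hmono
  have hND : Real.circleAverage (fun z => ‖SF (L + 1) a n z - SF (L + 1) b n z‖ ^ 2) 0 r
    = ND r (L + 1) a b n := rfl
  have hND' : Real.circleAverage (fun z => ‖SF L a (n + 1) z - SF L b (n + 1) z‖ ^ 2) 0 r
    = ND r L a b (n + 1) := rfl
  rw [hND, hND'] at hmono
  simp only [smul_eq_mul] at hmono
  have hNn : ‖a n - b n‖ ^ 2 ≤ ND r (L + 1) a b n := by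
    have h0 : 0 ≤ Real.circleAverage
      (fun z => ‖(SF (L + 1) a n z - SF (L + 1) b n z) - (a n - b n)‖ ^ 2) 0 r :=
      Real.circleAverage_nonneg_of_nonneg (fun z _ => by positivity)
    rw [ND_sub ha1 hb1 hr hr1] at h0
    linarith
  have hN0 : 0 ≤ ND r (L + 1) a b n := le_trans (by positivity) hNn
  refine hmono.trans ?_
  have hexp : (1 + k1 + k2) * (1 + k1 + k2) ≤ Real.exp (2 * (k1 + k2)) := by
    have h := Real.add_one_le_exp (k1 + k2)
    have : Real.exp (2 * (k1 + k2)) = Real.exp (k1 + k2) * Real.exp (k1 + k2) := by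
      rw [← Real.exp_add]; ring_nf
    rw [this]
    apply mul_le_mul <;> first | linarith | positivity
  calc A * (1 + k1 + k2) * (ND r (L + 1) a b n - ‖a n - b n‖ ^ 2 + k1 * ‖a n - b n‖ ^ 2
        + k2 * ND r (L + 1) a b n)
      ≤ A * (1 + k1 + k2) * ((1 + k1 + k2) * ND r (L + 1) a b n) := by
        have : 0 ≤ A := by positivity
        gcongr
        nlinarith [mul_le_mul_of_nonneg_left hNn hk1, sq_nonneg ‖a n - b n‖]
    _ = A * ((1 + k1 + k2) * (1 + k1 + k2)) * ND r (L + 1) a b n := by ring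
    _ ≤ A * Real.exp (2 * (k1 + k2)) * ND r (L + 1) a b n := by gcongr
    _ = _ := by rw [hA, ← Real.exp_add]; ring_nf

lemma ND_chain {a b : ℤ → ℂ} {c : ℝ} (hc : c < 1) (ha : ∀ n, ‖a n‖ ≤ c) (hb : ∀ n, ‖b n‖ ≤ c)
    {r : ℝ} (hr : 0 < r) (hr1 : r < 1) (L : ℕ) (i : ℕ) :
    ∀ n : ℤ, (r ^ i) ^ 2 * ND r L a b (n + i) ≤
      Real.exp (2 * GB r (1 / (1 - c)) (L + i) a b n) * ND r (L + i) a b n := by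
  have hτ : 0 ≤ 1 / (1 - c) := by
    have : 0 < 1 - c := by linarith
    positivity
  have hN : ∀ L n, 0 ≤ ND r L a b n := fun L n =>
    Real.circleAverage_nonneg_of_nonneg (fun z _ => by positivity)
  induction i with
  | zero =>
    intro n
    have := GB_nonneg hr.le hτ L a b n
    have : 1 ≤ Real.exp (2 * GB r (1 / (1 - c)) L a b n) := Real.one_le_exp (by linarith)
    have := hN L n
    simp only [pow_zero, one_pow, one_mul, Nat.cast_zero, add_zero]
    nlinarith
  | succ i ih =>
    intro n
    have h1 := ih (n + 1)
    have h2 := ND_step hc ha hb hr hr1 (L + i) n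
    have e : n + ((i + 1 : ℕ) : ℤ) = n + 1 + i := by push_cast; ring
    rw [e]
    have e2 : L + (i + 1) = L + i + 1 := by ring
    rw [e2]
    simp only [GB]
    rw [mul_add 2 _ (GB r (1 / (1 - c)) (L + i) a b (n + 1)), Real.exp_add]
    set P := Real.exp (2 * GB r (1 / (1 - c)) (L + i) a b (n + 1))
    have hP : 0 ≤ P := (Real.exp_pos _).le
    calc (r ^ (i + 1)) ^ 2 * ND r L a b (n + 1 + i)
        = r ^ 2 * ((r ^ i) ^ 2 * ND r L a b (n + 1 + i)) := by ring
      _ ≤ r ^ 2 * (P * ND r (L + i) a b (n + 1)) := by gcongr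
      _ = P * (r ^ 2 * ND r (L + i) a b (n + 1)) := by ring
      _ ≤ P * _ := mul_le_mul_of_nonneg_left h2 hP
      _ = _ := by ring

/-- Stability of Schur iterates. -/
lemma schur_stab {a b : ℤ → ℂ} {c S : ℝ} (hc : c < 1) (ha : ∀ n, ‖a n‖ ≤ c) (hb : ∀ n, ‖b n‖ ≤ c)
    {r : ℝ} (hr : 0 < r) (hr1 : r < 1) (L i : ℕ) (n : ℤ) (hS : 0 ≤ S)
    (hA : AB (L + 1 + i) a n ≤ S) (hB : AB (L + 1 + i) b n ≤ S) {δ : ℝ} (hδ0 : 0 ≤ δ)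
    (hδ : ∀ z : ℂ, ‖z‖ = r → ‖SF (L + 1 + i) a n z - SF (L + 1 + i) b n z‖ ≤ δ) :
    r ^ i * ‖a (n + i) - b (n + i)‖ ≤
      Real.exp (S * (2 + 1 / (1 - c)) * (4 / (1 - r) ^ 2 + 1)) * δ := by
  have ha1 : ∀ n, ‖a n‖ < 1 := fun n => (ha n).trans_lt hc
  have hb1 : ∀ n, ‖b n‖ < 1 := fun n => (hb n).trans_lt hc
  have hτ : 0 ≤ 1 / (1 - c) := by
    have : 0 < 1 - c := by linarith
    positivity
  have h1 := ND_chain hc ha hb hr hr1 (L + 1) i n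
  have hG := GB_final hτ hr hr1 (L + 1 + i) a b n hA hB hS
  have hcont := (SF_cont ha1 (L + 1 + i) n hr hr1).sub (SF_cont hb1 (L + 1 + i) n hr hr1)
  have hN : ND r (L + 1 + i) a b n ≤ δ ^ 2 := by
    refine Real.circleAverage_mono_on_of_le_circle (hcont.norm.pow 2).circleIntegrable' ?_
    intro z hz
    rw [abs_of_pos hr] at hz
    have := hδ z (by simpa using hz)
    gcongr
  have hNn : ‖a (n + i) - b (n + i)‖ ^ 2 ≤ ND r (L + 1) a b (n + i) := by
    have h0 : 0 ≤ Real.circleAverage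
      (fun z => ‖(SF (L + 1) a (n + i) z - SF (L + 1) b (n + i) z) - (a (n + i) - b (n + i))‖ ^ 2) 0 r :=
      Real.circleAverage_nonneg_of_nonneg (fun z _ => by positivity)
    rw [ND_sub ha1 hb1 hr hr1] at h0
    linarith
  refine le_of_sq_le_sq ?_ (by positivity)
  rw [mul_pow, mul_pow, ← Real.exp_nat_mul]
  push_cast
  calc (r ^ i) ^ 2 * ‖a (n + i) - b (n + i)‖ ^ 2 ≤ (r ^ i) ^ 2 * ND r (L + 1) a b (n + i) := by gcongr
    _ ≤ _ := h1
    _ ≤ _ := by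
      have : 0 ≤ ND r (L + 1 + i) a b n :=
        Real.circleAverage_nonneg_of_nonneg (fun z _ => by positivity)
      gcongr

lemma ricc_alg (z q Q u U v V g E : ℂ) (hz : z ≠ 0) (hd : 1 + Q * (z * g) ≠ 0) :
    ((I * (1 - Q * q) * (u + v) + z * (I * (q - v / z + (z + 1 / z - q * V - Q * v) * g
        + (Q - V * z) * g ^ 2) + E)) * (1 + Q * (z * g)) - (q + z * g) *
      ((-I * (1 - Q * q) * (U + V)) * (z * g) + Q * (z * (I * (q - v / z
        + (z + 1 / z - q * V - Q * v) * g + (Q - V * z) * g ^ 2) + E)))) / (1 + Q * (z * g)) ^ 2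
    = I * (u - q / z + (z + 1 / z - u * Q - U * q) * ((q + z * g) / (1 + Q * (z * g)))
        + (U - Q * z) * ((q + z * g) / (1 + Q * (z * g))) ^ 2)
      + z * (1 - Q * q) / (1 + Q * (z * g)) ^ 2 * E := by
  obtain ⟨D, hD⟩ : ∃ D, D = 1 + Q * (z * g) := ⟨_, rfl⟩
  rw [← hD] at hd ⊢
  field_simp
  rw [hD]
  ring

lemma conj_ALDeriv (q : ℝ → ℤ → ℂ) (s : ℝ) (n : ℤ) :
    (starRingEnd ℂ) (ALDeriv q s n) = -I * (1 - (starRingEnd ℂ) (q s n) * q s n) *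
      ((starRingEnd ℂ) (q s (n - 1)) + (starRingEnd ℂ) (q s (n + 1))) := by
  rw [Complex.conj_mul']
  simp [ALDeriv]

lemma riccati {q : ℝ → ℤ → ℂ} {s : ℝ} (hq : ∀ n, HasDerivAt (fun u => q u n) (ALDeriv q s n) s)
    (hb : ∀ n, ‖q s n‖ < 1) {z : ℂ} (hz0 : z ≠ 0) (hz : ‖z‖ ≤ 1) (L : ℕ) :
    ∀ n : ℤ, ∃ E : ℂ, HasDerivAt (fun u => SF L (q u) n z)
      (I * (q s (n - 1) - q s n / z + (z + 1 / z - q s (n - 1) * (starRingEnd ℂ) (q s n)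
        - (starRingEnd ℂ) (q s (n - 1)) * q s n) * SF L (q s) n z
        + ((starRingEnd ℂ) (q s (n - 1)) - (starRingEnd ℂ) (q s n) * z) * SF L (q s) n z ^ 2) + E) s ∧
      ‖E‖ ≤ (1 + 1 / ‖z‖) * ‖z‖ ^ L * (1 - ‖SF L (q s) n z‖ ^ 2) := by
  have hzp : 0 < ‖z‖ := by simpa using hz0
  induction L with
  | zero =>
    intro n
    refine ⟨-(I * (q s (n - 1) - q s n / z)), ?_, ?_⟩
    · simp only [SF]
      refine (hasDerivAt_const s (0:ℂ)).congr_deriv ?_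
      ring
    · simp only [SF, norm_neg, norm_mul, Complex.norm_I, one_mul, pow_zero, mul_one, norm_zero]
      refine (norm_sub_le _ _).trans ?_
      rw [norm_div]
      have h1 := (hb (n - 1)).le
      have h2 := (hb n).le
      have : ‖q s n‖ / ‖z‖ ≤ 1 / ‖z‖ := by gcongr
      simp only [ne_eq, OfNat.ofNat_ne_zero, not_false_eq_true, zero_pow, sub_zero, mul_one]
      linarith
  | succ L ih =>
    intro n
    obtain ⟨E, hE, hEb⟩ := ih (n + 1)
    have hsf := SF_lt hb L (n + 1) z hz
    have hzsf := zSF_lt hb L (n + 1) z hz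
    have hd := den_ne (hb n) hzsf
    rw [add_sub_cancel_right] at hE
    have h1 := (hq n)
    have h2 : HasDerivAt (fun u => (starRingEnd ℂ) (q u n)) ((starRingEnd ℂ) (ALDeriv q s n)) s :=
      h1.star
    have h3 := hE.const_mul z
    have h4 := (h1.add h3).div ((h2.mul h3).const_add 1) hd
    set g := SF L (q s) (n + 1) z with hg
    refine ⟨z * (1 - (starRingEnd ℂ) (q s n) * q s n) /
      (1 + (starRingEnd ℂ) (q s n) * (z * g)) ^ 2 * E, ?_, ?_⟩
    · rw [conj_ALDeriv] at h4
      have e : ALDeriv q s n = I * (1 - (starRingEnd ℂ) (q s n) * q s n) *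
          (q s (n - 1) + q s (n + 1)) := by
        rw [Complex.conj_mul']; simp [ALDeriv]
      rw [e] at h4
      simp only [SF]
      rw [← hg, ← ricc_alg z (q s n) ((starRingEnd ℂ) (q s n)) (q s (n - 1))
        ((starRingEnd ℂ) (q s (n - 1))) (q s (n + 1)) ((starRingEnd ℂ) (q s (n + 1))) g E hz0 hd]
      exact h4
    · simp only [SF]
      rw [← hg, mob_sub (hb n) hzsf, Complex.conj_mul', ← Complex.ofReal_pow, norm_mul, norm_div,
        norm_mul, norm_pow]
      have e : ‖(1:ℂ) - ((‖q s n‖ ^ 2 : ℝ) : ℂ)‖ = 1 - ‖q s n‖ ^ 2 := by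
        rw [← Complex.ofReal_one, ← Complex.ofReal_sub, Complex.norm_real, Real.norm_eq_abs,
          abs_of_nonneg]
        nlinarith [hb n, norm_nonneg (q s n)]
      rw [e]
      have hq0 : 0 ≤ 1 - ‖q s n‖ ^ 2 := by nlinarith [hb n, norm_nonneg (q s n)]
      have hD : 0 < ‖1 + (starRingEnd ℂ) (q s n) * (z * g)‖ := by simpa using hd
      set D := ‖1 + (starRingEnd ℂ) (q s n) * (z * g)‖
      have hmon : 1 - ‖g‖ ^ 2 ≤ 1 - ‖z * g‖ ^ 2 := by
        rw [norm_mul]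
        have : ‖z‖ * ‖g‖ ≤ ‖g‖ := by nlinarith [norm_nonneg g]
        have := pow_le_pow_left₀ (by positivity) this 2
        linarith
      calc ‖z‖ * (1 - ‖q s n‖ ^ 2) / D ^ 2 * ‖E‖
          ≤ ‖z‖ * (1 - ‖q s n‖ ^ 2) / D ^ 2 * ((1 + 1 / ‖z‖) * ‖z‖ ^ L * (1 - ‖z * g‖ ^ 2)) := by
            gcongr
            exact hEb.trans (by gcongr)
        _ = _ := by ring

lemma exp_bound {z : ℂ} {r : ℝ} (hr : 0 < r) (hr1 : r < 1) (hz : ‖z‖ = r) {s t : ℝ} (hs : 0 ≤ s)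
    (hst : s ≤ t) (σ : ℂ) (hσ : σ = I ∨ σ = -I) :
    ‖Complex.exp (σ * (z + 1 / z) * s)‖ ≤ Real.exp (t / r) := by
  rw [Complex.norm_exp]
  apply Real.exp_le_exp.2
  have hn : Complex.normSq z = r ^ 2 := by rw [Complex.normSq_eq_norm_sq, hz]
  have him : (z + 1 / z).im = z.im * (1 - 1 / r ^ 2) := by
    rw [one_div, Complex.add_im, Complex.inv_im, hn]
    ring
  have hzi : |z.im| ≤ r := hz ▸ Complex.abs_im_le_norm z
  have hb : |(z + 1 / z).im| ≤ 1 / r := by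
    rw [him, abs_mul]
    have h1 : (1:ℝ) ≤ 1 / r ^ 2 := by
      rw [le_div_iff₀ (by positivity)]; nlinarith
    rw [abs_of_nonpos (by linarith : 1 - 1 / r ^ 2 ≤ 0)]
    calc |z.im| * -(1 - 1 / r ^ 2) ≤ r * (1 / r ^ 2) := by
          apply mul_le_mul hzi _ (by linarith) hr.le
          linarith
      _ = 1 / r := by field_simp
  have hre : (σ * (z + 1 / z) * s).re ≤ |(z + 1 / z).im| * s := by
    rw [Complex.re_mul_ofReal]
    refine mul_le_mul_of_nonneg_right ?_ hs
    rcases hσ with rfl | rfl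
    · rw [Complex.I_mul_re]; exact neg_le_abs _
    · rw [neg_mul, Complex.neg_re, Complex.I_mul_re, neg_neg]; exact le_abs_self _
  refine hre.trans ?_
  calc |(z + 1 / z).im| * s ≤ 1 / r * t := by gcongr
    _ = t / r := by ring

lemma nl_bound {u q z f : ℂ} {r ε : ℝ} (hr : 0 < r) (hr1 : r < 1) (hz : ‖z‖ = r) (hu : ‖u‖ ≤ ε)
    (hq : ‖q‖ ≤ ε) (hu1 : ‖u‖ ≤ 1) (hf : ‖f‖ ≤ 1) :
    ‖u - q / z - (u * (starRingEnd ℂ) q + (starRingEnd ℂ) u * q) * f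
      + ((starRingEnd ℂ) u - (starRingEnd ℂ) q * z) * f ^ 2‖ ≤ 6 / r * ε := by
  have hε : 0 ≤ ε := (norm_nonneg _).trans hu
  have t1 : ‖q / z‖ ≤ 1 / r * ε := by
    rw [norm_div, hz, div_le_iff₀ hr]
    field_simp; exact hq
  have t2 : ‖(u * (starRingEnd ℂ) q + (starRingEnd ℂ) u * q) * f‖ ≤ 2 * ε := by
    have : ‖u * (starRingEnd ℂ) q + (starRingEnd ℂ) u * q‖ ≤ 2 * ε := by
      refine (norm_add_le _ _).trans ?_
      rw [norm_mul, norm_mul, RCLike.norm_conj, RCLike.norm_conj]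
      nlinarith [norm_nonneg u, norm_nonneg q]
    rw [norm_mul]
    nlinarith [norm_nonneg f]
  have t3 : ‖((starRingEnd ℂ) u - (starRingEnd ℂ) q * z) * f ^ 2‖ ≤ 2 * ε := by
    have : ‖(starRingEnd ℂ) u - (starRingEnd ℂ) q * z‖ ≤ 2 * ε := by
      refine (norm_sub_le _ _).trans ?_
      rw [norm_mul, RCLike.norm_conj, RCLike.norm_conj, hz]
      nlinarith [norm_nonneg q]
    rw [norm_mul, norm_pow]
    have h2 : ‖f‖ ^ 2 ≤ 1 := pow_le_one₀ (norm_nonneg _) hf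
    nlinarith [sq_nonneg ‖f‖]
  have h6 : 5 * ε + 1 / r * ε ≤ 6 / r * ε := by
    have : 1 ≤ 1 / r := by rw [le_div_iff₀ hr]; linarith
    have e : 6 / r = 6 * (1 / r) := by ring
    rw [e]; nlinarith
  refine (norm_add_le _ _).trans ?_
  have a1 := norm_sub_le (u - q / z) ((u * (starRingEnd ℂ) q + (starRingEnd ℂ) u * q) * f)
  have a2 := norm_sub_le u (q / z)
  linarith

lemma evolve {q p : ℝ → ℤ → ℂ} {t : ℝ} (ht : 0 ≤ t)
    (hq : ∀ s ∈ Set.Icc 0 t, ∀ n, HasDerivAt (fun u => q u n) (ALDeriv q s n) s)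
    (hp : ∀ s ∈ Set.Icc 0 t, ∀ n, HasDerivAt (fun u => p u n) (ALDeriv p s n) s)
    (hqb : ∀ s ∈ Set.Icc 0 t, ∀ n, ‖q s n‖ < 1) (hpb : ∀ s ∈ Set.Icc 0 t, ∀ n, ‖p s n‖ < 1)
    {r : ℝ} (hr : 0 < r) (hr1 : r < 1) {z : ℂ} (hz : ‖z‖ = r) (L : ℕ) (n : ℤ) {ε : ℝ}
    (hqe : ∀ s ∈ Set.Icc 0 t, ‖q s (n - 1)‖ ≤ ε ∧ ‖q s n‖ ≤ ε)
    (hpe : ∀ s ∈ Set.Icc 0 t, ‖p s (n - 1)‖ ≤ ε ∧ ‖p s n‖ ≤ ε) :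
    ‖SF L (q t) n z - SF L (p t) n z‖ ≤ Real.exp (t / r) *
      (‖SF L (q 0) n z - SF L (p 0) n z‖
        + t * (Real.exp (t / r) * (2 * (6 / r * ε + 2 / r * r ^ L)))) := by
  have hz0 : z ≠ 0 := by rw [← norm_pos_iff, hz]; exact hr
  have hz1 : ‖z‖ ≤ 1 := by linarith
  set ω := z + 1 / z with hω
  -- one solution: derivative is I ω f + remainder
  have one : ∀ y : ℝ → ℤ → ℂ,
      (∀ s ∈ Set.Icc 0 t, ∀ n, HasDerivAt (fun u => y u n) (ALDeriv y s n) s) →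
      (∀ s ∈ Set.Icc 0 t, ∀ n, ‖y s n‖ < 1) →
      (∀ s ∈ Set.Icc 0 t, ‖y s (n - 1)‖ ≤ ε ∧ ‖y s n‖ ≤ ε) → ∀ s ∈ Set.Icc 0 t,
      ∃ R : ℂ, HasDerivAt (fun u => SF L (y u) n z) (I * ω * SF L (y s) n z + R) s ∧
        ‖R‖ ≤ 6 / r * ε + 2 / r * r ^ L := by
    intro y hy hyb hye s hs
    obtain ⟨E, hE, hEb⟩ := riccati (hy s hs) (hyb s hs) hz0 hz1 L n
    have hf := (SF_lt (hyb s hs) L n z hz1).le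
    set f := SF L (y s) n z
    refine ⟨I * (y s (n - 1) - y s n / z - (y s (n - 1) * (starRingEnd ℂ) (y s n) +
      (starRingEnd ℂ) (y s (n - 1)) * y s n) * f
      + ((starRingEnd ℂ) (y s (n - 1)) - (starRingEnd ℂ) (y s n) * z) * f ^ 2) + E, ?_, ?_⟩
    · convert hE using 1
      ring
    · refine (norm_add_le _ _).trans ?_
      rw [norm_mul, Complex.norm_I, one_mul]
      have h1 := nl_bound (f := f) hr hr1 hz (hye s hs).1 (hye s hs).2 (hyb s hs (n - 1)).le hf
      refine add_le_add h1 (hEb.trans ?_)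
      rw [hz]
      have h3 : 1 + 1 / r ≤ 2 / r := by
        have : 1 ≤ 1 / r := by rw [le_div_iff₀ hr]; linarith
        have e : 2 / r = 2 * (1 / r) := by ring
        rw [e]; linarith
      calc (1 + 1 / r) * r ^ L * (1 - ‖f‖ ^ 2) ≤ (2 / r) * r ^ L * 1 := by
            have : 0 ≤ 1 - ‖f‖ ^ 2 := by nlinarith [norm_nonneg f]
            gcongr
            nlinarith [sq_nonneg ‖f‖]
        _ = _ := by ring
  choose! R1 hR1 hR1b using one q hq hqb hqe
  choose! R2 hR2 hR2b using one p hp hpb hpe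
  set B := Real.exp (t / r) * (2 * (6 / r * ε + 2 / r * r ^ L)) with hB
  set F : ℝ → ℂ := fun s => Complex.exp (-I * ω * s) * (SF L (q s) n z - SF L (p s) n z) with hF
  have hderiv : ∀ s ∈ Set.Icc 0 t, HasDerivAt F (Complex.exp (-I * ω * s) * (R1 s - R2 s)) s := by
    intro s hs
    have h1 : HasDerivAt (fun u : ℝ => Complex.exp (-I * ω * u))
        (Complex.exp (-I * ω * s) * (-I * ω)) s := by
      have h0 : HasDerivAt (fun u : ℝ => (u : ℂ)) 1 s := Complex.ofRealCLM.hasDerivAt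
      have := (h0.const_mul (-I * ω)).cexp
      simpa using this
    have h2 := h1.mul ((hR1 s hs).sub (hR2 s hs))
    refine h2.congr_deriv ?_
    simp only [Pi.sub_apply]
    ring
  have hbd : ∀ s ∈ Set.Icc 0 t, ‖Complex.exp (-I * ω * s) * (R1 s - R2 s)‖ ≤ B := by
    intro s hs
    rw [norm_mul, hB]
    have h1 := exp_bound hr hr1 hz hs.1 hs.2 (-I) (Or.inr rfl)
    have h2 := norm_sub_le (R1 s) (R2 s)
    have h3 := hR1b s hs
    have h4 := hR2b s hs
    gcongr
    linarith
  have hmv := (convex_Icc (0:ℝ) t).norm_image_sub_le_of_norm_hasDerivWithin_le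
    (fun s hs => (hderiv s hs).hasDerivWithinAt) hbd
    (Set.left_mem_Icc.2 ht) (Set.right_mem_Icc.2 ht)
  rw [sub_zero, Real.norm_eq_abs, abs_of_nonneg ht] at hmv
  have h0 : F 0 = SF L (q 0) n z - SF L (p 0) n z := by simp [hF]
  have hFt : ‖F t‖ ≤ ‖SF L (q 0) n z - SF L (p 0) n z‖ + t * B := by
    rw [← h0]
    have := norm_sub_norm_le (F t) (F 0)
    linarith
  have hinv : SF L (q t) n z - SF L (p t) n z = Complex.exp (I * ω * t) * F t := by
    simp only [hF]
    rw [← mul_assoc, ← Complex.exp_add]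
    have : I * ω * t + -I * ω * t = 0 := by ring
    rw [this]; simp
  rw [hinv, norm_mul]
  have h1 := exp_bound hr hr1 hz ht le_rfl I (Or.inl rfl)
  gcongr

lemma ALDeriv_sub {q p : ℝ → ℤ → ℂ} {s : ℝ} (hq : ∀ n, ‖q s n‖ ≤ 1) (hp : ∀ n, ‖p s n‖ ≤ 1) (n : ℤ) :
    ‖ALDeriv q s n - ALDeriv p s n‖ ≤ ‖q s (n - 1) - p s (n - 1)‖ + ‖q s (n + 1) - p s (n + 1)‖
      + 4 * ‖q s n - p s n‖ := by
  have e : ALDeriv q s n - ALDeriv p s n = I * (((1 - ‖q s n‖ ^ 2 : ℝ) : ℂ) *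
      ((q s (n - 1) - p s (n - 1)) + (q s (n + 1) - p s (n + 1)))
      + ((‖p s n‖ ^ 2 - ‖q s n‖ ^ 2 : ℝ) : ℂ) * (p s (n - 1) + p s (n + 1))) := by
    simp only [ALDeriv]; push_cast; ring
  rw [e, norm_mul, Complex.norm_I, one_mul]
  refine (norm_add_le _ _).trans ?_
  rw [norm_mul, norm_mul, Complex.norm_real, Complex.norm_real, Real.norm_eq_abs, Real.norm_eq_abs]
  have h1 : |1 - ‖q s n‖ ^ 2| ≤ 1 := by
    rw [abs_le]; constructor <;> nlinarith [hq n, norm_nonneg (q s n)]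
  have h2 : |‖p s n‖ ^ 2 - ‖q s n‖ ^ 2| ≤ 2 * ‖q s n - p s n‖ := by
    have e : ‖p s n‖ ^ 2 - ‖q s n‖ ^ 2 = (‖p s n‖ + ‖q s n‖) * (‖p s n‖ - ‖q s n‖) := by ring
    rw [e, abs_mul, abs_of_nonneg (by positivity)]
    have := abs_norm_sub_norm_le (p s n) (q s n)
    rw [norm_sub_rev] at this
    have := hq n
    have := hp n
    gcongr
    linarith
  have h3 := norm_add_le (q s (n - 1) - p s (n - 1)) (q s (n + 1) - p s (n + 1))
  have h4 : ‖p s (n - 1) + p s (n + 1)‖ ≤ 2 :=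
    (norm_add_le _ _).trans (by linarith [hp (n - 1), hp (n + 1)])
  have h5 : |1 - ‖q s n‖ ^ 2| * ‖q s (n - 1) - p s (n - 1) + (q s (n + 1) - p s (n + 1))‖
      ≤ 1 * (‖q s (n - 1) - p s (n - 1)‖ + ‖q s (n + 1) - p s (n + 1)‖) := by gcongr
  have h6 : |‖p s n‖ ^ 2 - ‖q s n‖ ^ 2| * ‖p s (n - 1) + p s (n + 1)‖
      ≤ (2 * ‖q s n - p s n‖) * 2 := by gcongr
  linarith

lemma crude {q p : ℝ → ℤ → ℂ} {t : ℝ}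
    (hq : ∀ s ∈ Set.Icc 0 t, ∀ n, HasDerivAt (fun u => q u n) (ALDeriv q s n) s)
    (hp : ∀ s ∈ Set.Icc 0 t, ∀ n, HasDerivAt (fun u => p u n) (ALDeriv p s n) s)
    (hqb : ∀ s ∈ Set.Icc 0 t, ∀ n, ‖q s n‖ ≤ 1) (hpb : ∀ s ∈ Set.Icc 0 t, ∀ n, ‖p s n‖ ≤ 1)
    {w : ℤ → ℝ} {κ A : ℝ} (hA : 0 ≤ A)
    (hw1 : ∀ n, w (n + 1) ≤ κ * w n) (hw2 : ∀ n, w (n - 1) ≤ κ * w n)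
    (h0 : ∀ n, ‖q 0 n - p 0 n‖ ≤ A * w n) :
    ∀ n, ∀ s ∈ Set.Icc 0 t, ‖q s n - p s n‖ ≤ A * w n * Real.exp ((2 * κ + 4) * s) := by
  have hk : ∀ k : ℕ, ∀ n, ∀ s ∈ Set.Icc 0 t, ‖q s n - p s n‖ ≤
      A * w n * Real.exp ((2 * κ + 4) * s) + 2 * ((6 * s) ^ k / (k.factorial : ℝ)) := by
    intro k
    induction k with
    | zero =>
      intro n s hs
      have h1 := norm_sub_le (q s n) (p s n)
      have h2 := hqb s hs n
      have h3 := hpb s hs n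
      have h4 : 0 ≤ A * w n := (norm_nonneg _).trans (h0 n)
      have : 0 ≤ A * w n * Real.exp ((2 * κ + 4) * s) := by positivity
      simp
      linarith
    | succ k ih =>
      intro n
      refine image_norm_le_of_norm_deriv_right_le_deriv_boundary' (f := fun s => q s n - p s n)
        (f' := fun s => ALDeriv q s n - ALDeriv p s n)
        (B := fun s => A * w n * Real.exp ((2 * κ + 4) * s)
          + 2 * ((6 * s) ^ (k + 1) / ((k + 1).factorial : ℝ)))
        (B' := fun s => A * w n * (Real.exp ((2 * κ + 4) * s) * (2 * κ + 4))
          + 12 * ((6 * s) ^ k / (k.factorial : ℝ))) ?_ ?_ ?_ ?_ ?_ ?_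
      · intro s hs
        exact ((hq s hs n).sub (hp s hs n)).continuousAt.continuousWithinAt
      · intro s hs
        exact ((hq s ⟨hs.1, hs.2.le⟩ n).sub (hp s ⟨hs.1, hs.2.le⟩ n)).hasDerivWithinAt
      · simpa using h0 n
      · fun_prop
      · intro s hs
        refine HasDerivAt.hasDerivWithinAt ?_
        have h1 : HasDerivAt (fun s : ℝ => Real.exp ((2 * κ + 4) * s))
            (Real.exp ((2 * κ + 4) * s) * (2 * κ + 4)) s := by
          have := ((hasDerivAt_id s).const_mul (2 * κ + 4)).exp
          simpa using this
        have h2 : HasDerivAt (fun s : ℝ => (6 * s) ^ (k + 1)) (((k + 1 : ℕ) : ℝ) * (6 * s) ^ k * 6) s := by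
          have := ((hasDerivAt_id s).const_mul (6:ℝ)).fun_pow (k + 1)
          simpa using this
        refine ((h1.const_mul (A * w n)).add ((h2.div_const _).const_mul 2)).congr_deriv ?_
        congr 1
        rw [Nat.factorial_succ]
        have : (k.factorial : ℝ) ≠ 0 := by positivity
        push_cast
        field_simp
        ring
      · intro s hs
        have hs' : s ∈ Set.Icc 0 t := ⟨hs.1, hs.2.le⟩
        refine (ALDeriv_sub (hqb s hs') (hpb s hs') n).trans ?_
        have a1 := ih (n - 1) s hs'
        have a2 := ih (n + 1) s hs'
        have a3 := ih n s hs'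
        have hE := Real.exp_pos ((2 * κ + 4) * s)
        set X := Real.exp ((2 * κ + 4) * s)
        set Y := (6 * s) ^ k / (k.factorial : ℝ)
        have b1 : A * w (n - 1) * X ≤ A * (κ * w n) * X := by gcongr; exact hw2 n
        have b2 : A * w (n + 1) * X ≤ A * (κ * w n) * X := by gcongr; exact hw1 n
        nlinarith
  intro n s hs
  have hl : Tendsto (fun k : ℕ => A * w n * Real.exp ((2 * κ + 4) * s) +
      2 * ((6 * s) ^ k / (k.factorial : ℝ))) atTop
      (nhds (A * w n * Real.exp ((2 * κ + 4) * s) + 2 * 0)) :=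
    ((FloorSemiring.tendsto_pow_div_factorial_atTop (6 * s)).const_mul 2).const_add _
  rw [mul_zero, add_zero] at hl
  exact ge_of_tendsto hl (Eventually.of_forall fun k => hk k n s hs)

lemma zero_AL (s : ℝ) (n : ℤ) :
    HasDerivAt (fun u => (fun (_ : ℝ) (_ : ℤ) => (0:ℂ)) u n)
      (ALDeriv (fun (_ : ℝ) (_ : ℤ) => (0:ℂ)) s n) s := by
  refine (hasDerivAt_const s (0:ℂ)).congr_deriv ?_
  simp [ALDeriv]

lemma decay {q : ℝ → ℤ → ℂ} {t : ℝ}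
    (hq : ∀ s ∈ Set.Icc 0 t, ∀ n, HasDerivAt (fun u => q u n) (ALDeriv q s n) s)
    (hqb : ∀ s ∈ Set.Icc 0 t, ∀ n, ‖q s n‖ < 1) (ht : 0 ≤ t)
    {M : ℕ} (hM : ∀ n : ℤ, M < n.natAbs → q 0 n = 0) {ρ : ℝ} (hρ : 0 < ρ) (hρ1 : ρ < 1) :
    ∃ A, 0 ≤ A ∧ ∀ s ∈ Set.Icc 0 t, ∀ n : ℤ, ‖q s n‖ ≤ A * ρ ^ n.natAbs := by
  have hw : ∀ m n : ℤ, n.natAbs ≤ m.natAbs + 1 → ρ ^ m.natAbs ≤ 1 / ρ * ρ ^ n.natAbs := by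
    intro m n h
    rw [one_div, inv_mul_eq_div, le_div_iff₀ hρ, ← pow_succ]
    exact pow_le_pow_of_le_one hρ.le hρ1.le h
  have hA : (0:ℝ) ≤ (1 / ρ) ^ M := by positivity
  have h := crude hq (fun s _ n => zero_AL s n) (fun s hs n => (hqb s hs n).le)
    (fun s _ n => by simp) (w := fun n => ρ ^ n.natAbs) (κ := 1 / ρ) hA
    (fun n => hw (n + 1) n (by omega)) (fun n => hw (n - 1) n (by omega)) (by
      intro n
      simp only [sub_zero]
      by_cases hn : M < n.natAbs
      · rw [hM n hn]; simp; positivity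
      · refine (hqb 0 ⟨le_rfl, ht⟩ n).le.trans ?_
        rw [one_div, inv_pow, inv_mul_eq_div, le_div_iff₀ (by positivity), one_mul]
        exact pow_le_pow_of_le_one hρ.le hρ1.le (by omega))
  refine ⟨(1 / ρ) ^ M * Real.exp ((2 * (1 / ρ) + 4) * t), by positivity, ?_⟩
  intro s hs n
  have h1 := h n s hs
  rw [sub_zero] at h1
  refine h1.trans ?_
  rw [mul_right_comm]
  have := hs.2
  gcongr

lemma sum_Icc_range (g : ℤ → ℝ) (K : ℕ) :
    ∑ k ∈ Finset.Icc (-(K:ℤ)) K, g k = ∑ i ∈ Finset.range (2 * K + 1), g (-(K:ℤ) + i) := by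
  symm
  refine Finset.sum_nbij (fun i : ℕ => -(K:ℤ) + i) ?_ ?_ ?_ ?_
  · intro i hi; simp at hi ⊢; omega
  · intro i _ j _ h; simpa using h
  · intro k hk
    simp at hk ⊢
    exact ⟨(k + K).toNat, by omega, by omega⟩
  · intro i _; rfl

lemma log_deriv {q : ℝ → ℤ → ℂ} {s : ℝ} {n : ℤ}
    (hq : HasDerivAt (fun u => q u n) (ALDeriv q s n) s) (hb : ‖q s n‖ < 1) :
    HasDerivAt (fun u => Real.log (1 - ‖q u n‖ ^ 2))
      (2 * ((starRingEnd ℂ) (q s n) * q s (n + 1)).im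
        - 2 * ((starRingEnd ℂ) (q s (n - 1)) * q s n).im) s := by
  have hne : 1 - ‖q s n‖ ^ 2 ≠ 0 := by nlinarith [norm_nonneg (q s n)]
  have h1 := ((hq.norm_sq.const_sub 1).log hne)
  refine h1.congr_deriv ?_
  rw [div_eq_iff hne, Complex.inner]
  simp [ALDeriv]
  set c := ‖q s n‖ ^ 2
  have e : ((c : ℂ)) = ((c : ℝ) : ℂ) := rfl
  rw [← Complex.ofReal_pow]
  simp only [Complex.ofReal_re, Complex.ofReal_im]
  ring

lemma conserve {q : ℝ → ℤ → ℂ} {t : ℝ} (ht : 0 ≤ t)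
    (hq : ∀ s ∈ Set.Icc 0 t, ∀ n, HasDerivAt (fun u => q u n) (ALDeriv q s n) s)
    (hqb : ∀ s ∈ Set.Icc 0 t, ∀ n, ‖q s n‖ < 1)
    {M : ℕ} (hM : ∀ n : ℤ, M < n.natAbs → q 0 n = 0) {ℓ : ℝ}
    (hℓ : ∀ K : ℕ, ℓ ≤ ∑ k ∈ Finset.Icc (-(K:ℤ)) K, Real.log (1 - ‖q 0 k‖ ^ 2)) (K : ℕ) :
    ℓ ≤ ∑ k ∈ Finset.Icc (-(K:ℤ)) K, Real.log (1 - ‖q t k‖ ^ 2) := by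
  obtain ⟨A, hA, hdec⟩ := decay hq hqb ht hM (ρ := 1 / 2) (by norm_num) (by norm_num)
  have key : ∀ m : ℕ, ℓ ≤ ∑ k ∈ Finset.Icc (-(m:ℤ)) m, Real.log (1 - ‖q t k‖ ^ 2)
      + 4 * A * (1 / 2) ^ m * t := by
    intro m
    have hd : ∀ s ∈ Set.Icc 0 t, HasDerivAt
        (fun u => ∑ k ∈ Finset.Icc (-(m:ℤ)) m, Real.log (1 - ‖q u k‖ ^ 2))
        (2 * ((starRingEnd ℂ) (q s m) * q s (m + 1)).im
        - 2 * ((starRingEnd ℂ) (q s (-m - 1)) * q s (-m)).im) s := by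
      intro s hs
      have := HasDerivAt.fun_sum (u := Finset.Icc (-(m:ℤ)) m)
        (fun k _ => log_deriv (hq s hs k) (hqb s hs k))
      refine this.congr_deriv ?_
      rw [sum_Icc_range]
      have tel := Finset.sum_range_sub
        (fun i : ℕ => 2 * ((starRingEnd ℂ) (q s (-(m:ℤ) + i - 1)) * q s (-(m:ℤ) + i)).im) (2 * m + 1)
      have e1 : -(m:ℤ) + ((2 * m + 1 : ℕ) : ℤ) = m + 1 := by push_cast; ring
      simp only [e1, Nat.cast_zero, add_zero, add_sub_cancel_right] at tel
      rw [← tel]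
      refine Finset.sum_congr rfl fun i _ => ?_
      have e2 : -(m:ℤ) + ((i + 1 : ℕ) : ℤ) = -(m:ℤ) + i + 1 := by push_cast; ring
      rw [e2, add_sub_cancel_right]
    have hbd : ∀ s ∈ Set.Icc 0 t, ‖2 * ((starRingEnd ℂ) (q s m) * q s (m + 1)).im
        - 2 * ((starRingEnd ℂ) (q s (-m - 1)) * q s (-m)).im‖ ≤ 4 * A * (1 / 2) ^ m := by
      intro s hs
      have b : ∀ k l : ℤ, k.natAbs = m → |((starRingEnd ℂ) (q s l) * q s k).im| ≤ A * (1 / 2) ^ m ∧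
          |((starRingEnd ℂ) (q s k) * q s l).im| ≤ A * (1 / 2) ^ m := by
        intro k l hk
        have h1 := hdec s hs k
        rw [hk] at h1
        have h2 := (hqb s hs l).le
        constructor <;>
        · refine (Complex.abs_im_le_norm _).trans ?_
          rw [norm_mul, RCLike.norm_conj]
          nlinarith [norm_nonneg (q s l), norm_nonneg (q s k)]
      have b1 := (b m (m + 1) (by simp)).2
      have b2 := (b (-m) (-m - 1) (by simp)).1
      rw [Real.norm_eq_abs]
      rw [abs_le] at b1 b2 ⊢
      constructor <;> linarith
    have hmv := (convex_Icc (0:ℝ) t).norm_image_sub_le_of_norm_hasDerivWithin_le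
      (fun s hs => (hd s hs).hasDerivWithinAt) hbd
      (Set.left_mem_Icc.2 ht) (Set.right_mem_Icc.2 ht)
    rw [sub_zero, Real.norm_eq_abs, Real.norm_eq_abs, abs_of_nonneg ht, abs_le] at hmv
    linarith [hℓ m, hmv.1]
  have hmono : ∀ m : ℕ, K ≤ m → ℓ ≤ ∑ k ∈ Finset.Icc (-(K:ℤ)) K, Real.log (1 - ‖q t k‖ ^ 2)
      + 4 * A * (1 / 2) ^ m * t := by
    intro m hm
    have : ∑ k ∈ Finset.Icc (-(m:ℤ)) m, Real.log (1 - ‖q t k‖ ^ 2) ≤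
        ∑ k ∈ Finset.Icc (-(K:ℤ)) K, Real.log (1 - ‖q t k‖ ^ 2) := by
      have h := Finset.sum_le_sum_of_subset_of_nonneg (s := Finset.Icc (-(K:ℤ)) K)
        (t := Finset.Icc (-(m:ℤ)) m) (f := fun k => -Real.log (1 - ‖q t k‖ ^ 2))
        (Finset.Icc_subset_Icc (by omega) (by omega)) (by
          intro k _ _
          have := hqb t ⟨ht, le_rfl⟩ k
          have : Real.log (1 - ‖q t k‖ ^ 2) ≤ 0 :=
            Real.log_nonpos (by nlinarith [norm_nonneg (q t k)]) (by nlinarith [norm_nonneg (q t k)])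
          linarith)
      rw [Finset.sum_neg_distrib, Finset.sum_neg_distrib] at h
      linarith
    linarith [key m]
  have hl : Tendsto (fun m : ℕ => ∑ k ∈ Finset.Icc (-(K:ℤ)) K, Real.log (1 - ‖q t k‖ ^ 2)
      + 4 * A * (1 / 2) ^ m * t) atTop
      (nhds (∑ k ∈ Finset.Icc (-(K:ℤ)) K, Real.log (1 - ‖q t k‖ ^ 2) + 4 * A * 0 * t)) :=
    (((tendsto_pow_atTop_nhds_zero_of_lt_one (by norm_num) (by norm_num)).const_mul _).mul_const
      _).const_add _
  simp only [mul_zero, zero_mul, add_zero] at hl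
  exact ge_of_tendsto hl (eventually_atTop.2 ⟨K, hmono⟩)

lemma AB_eq (L : ℕ) (a : ℤ → ℂ) : ∀ n, AB L a n = ∑ i ∈ Finset.range L, ‖a (n + i)‖ ^ 2 := by
  induction L with
  | zero => intro n; simp [AB]
  | succ L ih =>
    intro n
    rw [Finset.sum_range_succ', AB, ih (n + 1)]
    simp only [Nat.cast_zero, add_zero]
    rw [add_comm]
    congr 1
    refine Finset.sum_congr rfl fun i _ => ?_
    congr 3
    push_cast; ring

lemma AB_le {a : ℤ → ℂ} (ha : ∀ n, ‖a n‖ < 1) {ℓ : ℝ}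
    (h : ∀ K : ℕ, ℓ ≤ ∑ k ∈ Finset.Icc (-(K:ℤ)) K, Real.log (1 - ‖a k‖ ^ 2)) (L : ℕ) (n : ℤ) :
    AB L a n ≤ -ℓ := by
  have hK := h (n.natAbs + L)
  set K := n.natAbs + L
  have hpos : ∀ k, 0 < 1 - ‖a k‖ ^ 2 := fun k => by nlinarith [ha k, norm_nonneg (a k)]
  have h1 : ∑ k ∈ Finset.Icc (-(K:ℤ)) K, ‖a k‖ ^ 2 ≤ -ℓ := by
    have : ∑ k ∈ Finset.Icc (-(K:ℤ)) K, Real.log (1 - ‖a k‖ ^ 2) ≤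
        ∑ k ∈ Finset.Icc (-(K:ℤ)) K, -‖a k‖ ^ 2 :=
      Finset.sum_le_sum fun k _ => by linarith [Real.log_le_sub_one_of_pos (hpos k)]
    rw [Finset.sum_neg_distrib] at this
    linarith
  refine le_trans ?_ h1
  rw [AB_eq]
  have : ∑ i ∈ Finset.range L, ‖a (n + i)‖ ^ 2 =
      ∑ k ∈ (Finset.range L).image (fun i : ℕ => n + (i:ℤ)), ‖a k‖ ^ 2 := by
    rw [Finset.sum_image]
    intro i _ j _ hij; simpa using hij
  rw [this]
  refine Finset.sum_le_sum_of_subset_of_nonneg ?_ (fun _ _ _ => by positivity)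
  intro k hk
  simp at hk ⊢
  obtain ⟨i, hi, rfl⟩ := hk
  omega

lemma coef_le {a : ℤ → ℂ} (ha : ∀ n, ‖a n‖ < 1) {η : ℝ} (hη : 0 < η)
    (h : ∀ K : ℕ, Real.log η ≤ ∑ k ∈ Finset.Icc (-(K:ℤ)) K, Real.log (1 - ‖a k‖ ^ 2)) (n : ℤ) :
    ‖a n‖ ≤ Real.sqrt (1 - η) := by
  have hpos : ∀ k, 0 < 1 - ‖a k‖ ^ 2 := fun k => by nlinarith [ha k, norm_nonneg (a k)]
  have hK := h n.natAbs
  have h1 : -Real.log (1 - ‖a n‖ ^ 2) ≤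
      ∑ k ∈ Finset.Icc (-(n.natAbs:ℤ)) n.natAbs, -Real.log (1 - ‖a k‖ ^ 2) := by
    refine Finset.single_le_sum (f := fun k => -Real.log (1 - ‖a k‖ ^ 2)) ?_ ?_
    · intro k _
      have : Real.log (1 - ‖a k‖ ^ 2) ≤ 0 :=
        Real.log_nonpos (hpos k).le (by nlinarith [norm_nonneg (a k)])
      simpa using this
    · rw [Finset.mem_Icc]; omega
  rw [Finset.sum_neg_distrib] at h1
  have h2 : Real.log η ≤ Real.log (1 - ‖a n‖ ^ 2) := by linarith
  have h3 := (Real.log_le_log_iff hη (hpos n)).1 h2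
  exact Real.le_sqrt_of_sq_le (by linarith)

lemma compare {q p : ℝ → ℤ → ℂ} {t : ℝ} (ht : 0 ≤ t)
    (hq : ∀ s ∈ Set.Icc 0 t, ∀ n, HasDerivAt (fun u => q u n) (ALDeriv q s n) s)
    (hp : ∀ s ∈ Set.Icc 0 t, ∀ n, HasDerivAt (fun u => p u n) (ALDeriv p s n) s)
    (hqb : ∀ s ∈ Set.Icc 0 t, ∀ n, ‖q s n‖ < 1) (hpb : ∀ s ∈ Set.Icc 0 t, ∀ n, ‖p s n‖ < 1)
    {M : ℕ} (hqM : ∀ n : ℤ, M < n.natAbs → q 0 n = 0) (hpM : ∀ n : ℤ, M < n.natAbs → p 0 n = 0)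
    {η : ℝ} (hη : 0 < η) (hη1 : η ≤ 1)
    (hqη : ∀ K : ℕ, Real.log η ≤ ∑ k ∈ Finset.Icc (-(K:ℤ)) K, Real.log (1 - ‖q 0 k‖ ^ 2))
    (hpη : ∀ K : ℕ, Real.log η ≤ ∑ k ∈ Finset.Icc (-(K:ℤ)) K, Real.log (1 - ‖p 0 k‖ ^ 2))
    {N : ℕ} (hag : ∀ n : ℤ, n ≤ N → q 0 n = p 0 n)
    {r : ℝ} (hr : 0 < r) (hr1 : r < 1) {j : ℤ} {κ : ℕ} (hj : j + κ = N + 1) (hκ : 0 < κ) :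
    ‖q t j - p t j‖ ≤ 2 * Real.exp (t / r) * Cconst η r * r ^ κ := by
  have htm : t ∈ Set.Icc 0 t := ⟨ht, le_rfl⟩
  have h0m : (0:ℝ) ∈ Set.Icc 0 t := ⟨le_rfl, ht⟩
  have hρ : 0 < r ^ 2 := by positivity
  have hρ1 : r ^ 2 < 1 := by nlinarith
  obtain ⟨A1, hA1, hd1⟩ := decay hq hqb ht hqM hρ hρ1
  obtain ⟨A2, hA2, hd2⟩ := decay hp hpb ht hpM hρ hρ1
  have cq := conserve ht hq hqb hqM hqη
  have cp := conserve ht hp hpb hpM hpη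
  have hc : Real.sqrt (1 - η) < 1 := by
    rw [Real.sqrt_lt' one_pos]; linarith
  have hS : 0 ≤ Real.log (1 / η) := Real.log_nonneg (by rw [le_div_iff₀ hη]; linarith)
  have hlog : -Real.log η = Real.log (1 / η) := by rw [one_div, Real.log_inv]
  have key : ∀ l : ℕ, ‖q t j - p t j‖ ≤ Cconst η r * (Real.exp (t / r) *
      (2 * r ^ κ + (t * (Real.exp (t / r) * (2 * (6 / r * (A1 + A2) + 2 / r)))) * r ^ l)) := by
    intro l
    set m := j.natAbs + l with hm
    obtain ⟨i, hi⟩ : ∃ i : ℕ, (i:ℤ) = m + j := ⟨(m + j).toNat, by omega⟩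
    obtain ⟨i', hi'⟩ : ∃ i' : ℕ, (i':ℤ) = m - j := ⟨(m - j).toNat, by omega⟩
    have hi2 : 2 * m = i + i' := by omega
    have hi'l : l ≤ i' := by omega
    obtain ⟨κ', rfl⟩ : ∃ κ', κ = κ' + 1 := ⟨κ - 1, by omega⟩
    set ε := (A1 + A2) * r ^ (2 * m) with hε
    have hsmall : ∀ (A : ℝ), 0 ≤ A → A ≤ A1 + A2 → ∀ n : ℤ, m ≤ n.natAbs →
        A * (r ^ 2) ^ n.natAbs ≤ ε := by
      intro A hA hAA n hn
      rw [hε, ← pow_mul]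
      have : r ^ (2 * n.natAbs) ≤ r ^ (2 * m) := pow_le_pow_of_le_one hr.le hr1.le (by omega)
      gcongr
    have hst := schur_stab hc (coef_le (hqb t htm) hη cq) (coef_le (hpb t htm) hη cp) hr hr1
      (κ' + m) i (-(m:ℤ)) hS (hlog ▸ AB_le (hqb t htm) cq _ _) (hlog ▸ AB_le (hpb t htm) cp _ _)
      (δ := Real.exp (t / r) * (2 * r ^ (i + (κ' + 1))
        + t * (Real.exp (t / r) * (2 * (6 / r * ε + 2 / r * r ^ (κ' + m + 1 + i))))))
      (by positivity) (by
        intro z hz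
        refine (evolve ht hq hp hqb hpb hr hr1 hz (κ' + m + 1 + i) (-(m:ℤ)) (ε := ε) ?_ ?_).trans ?_
        · intro s hs
          exact ⟨(hd1 s hs _).trans (hsmall A1 hA1 (by linarith) _ (by omega)),
            (hd1 s hs _).trans (hsmall A1 hA1 (by linarith) _ (by omega))⟩
        · intro s hs
          exact ⟨(hd2 s hs _).trans (hsmall A2 hA2 (by linarith) _ (by omega)),
            (hd2 s hs _).trans (hsmall A2 hA2 (by linarith) _ (by omega))⟩
        · have hcl := SF_close (hqb 0 h0m) (hpb 0 h0m) (i + (κ' + 1)) m (-(m:ℤ)) (by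
            intro k _ hk2
            apply hag
            push_cast at hk2 hj
            omega) z (by linarith)
          rw [hz] at hcl
          have e : κ' + m + 1 + i = i + (κ' + 1) + m := by ring
          rw [e]
          gcongr)
    have ej : -(m:ℤ) + i = j := by omega
    rw [ej] at hst
    have hri : 0 < r ^ i := by positivity
    refine le_of_mul_le_mul_left (hst.trans ?_) hri
    rw [show Real.exp (Real.log (1 / η) * (2 + 1 / (1 - Real.sqrt (1 - η))) *
      (4 / (1 - r) ^ 2 + 1)) = Cconst η r from rfl]
    have hCc : 0 < Cconst η r := Real.exp_pos _
    have p1 : ε ≤ r ^ i * ((A1 + A2) * r ^ l) := by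
      rw [hε, hi2, pow_add]
      have : r ^ i' ≤ r ^ l := pow_le_pow_of_le_one hr.le hr1.le hi'l
      calc (A1 + A2) * (r ^ i * r ^ i') ≤ (A1 + A2) * (r ^ i * r ^ l) := by gcongr
        _ = _ := by ring
    have p2 : r ^ (κ' + m + 1 + i) ≤ r ^ i * r ^ l := by
      rw [← pow_add]
      exact pow_le_pow_of_le_one hr.le hr1.le (by omega)
    calc Cconst η r * (Real.exp (t / r) * (2 * r ^ (i + (κ' + 1))
        + t * (Real.exp (t / r) * (2 * (6 / r * ε + 2 / r * r ^ (κ' + m + 1 + i))))))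
        ≤ Cconst η r * (Real.exp (t / r) * (2 * r ^ (i + (κ' + 1))
        + t * (Real.exp (t / r) * (2 * (6 / r * (r ^ i * ((A1 + A2) * r ^ l))
          + 2 / r * (r ^ i * r ^ l)))))) := by gcongr
      _ = _ := by rw [pow_add]; ring
  have hl : Tendsto (fun l : ℕ => Cconst η r * (Real.exp (t / r) *
      (2 * r ^ κ + (t * (Real.exp (t / r) * (2 * (6 / r * (A1 + A2) + 2 / r)))) * r ^ l))) atTop
      (nhds (Cconst η r * (Real.exp (t / r) *
      (2 * r ^ κ + (t * (Real.exp (t / r) * (2 * (6 / r * (A1 + A2) + 2 / r)))) * 0)))) :=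
    ((((tendsto_pow_atTop_nhds_zero_of_lt_one hr.le hr1).const_mul _).const_add _).const_mul
      _).const_mul _
  refine (ge_of_tendsto hl (Eventually.of_forall key)).trans (le_of_eq ?_)
  ring

/-- Clipping of real and imaginary parts to `[-1,1]`. -/
def clipC (w : ℂ) : ℂ := ⟨max (-1) (min 1 w.re), max (-1) (min 1 w.im)⟩

/-- The cut-off of `1 - |w|²`. -/
def cutG (w : ℂ) : ℝ := 1 - (min 1 ‖w‖) ^ 2

lemma clip_real_lip (a b : ℝ) : |max (-1) (min 1 a) - max (-1) (min 1 b)| ≤ |a - b| := by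
  have h1 := abs_max_sub_max_le_max (-1 : ℝ) (min 1 a) (-1) (min 1 b)
  have h2 := abs_min_sub_min_le_max (1 : ℝ) a 1 b
  simp at h1 h2
  exact h1.trans h2

lemma clip_real_abs (a : ℝ) : |max (-1) (min 1 a)| ≤ 1 := by
  rw [abs_le]
  exact ⟨le_max_left _ _, max_le (by norm_num) (min_le_left _ _)⟩

lemma clipC_norm (w : ℂ) : ‖clipC w‖ ≤ 2 := by
  have h := Complex.norm_le_abs_re_add_abs_im (clipC w)
  have h1 := clip_real_abs w.re
  have h2 := clip_real_abs w.im
  simp only [clipC] at h ⊢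
  linarith

lemma clipC_lip (a b : ℂ) : ‖clipC a - clipC b‖ ≤ 2 * ‖a - b‖ := by
  have h := Complex.norm_le_abs_re_add_abs_im (clipC a - clipC b)
  have h1 := clip_real_lip a.re b.re
  have h2 := clip_real_lip a.im b.im
  have h3 := Complex.abs_re_le_norm (a - b)
  have h4 := Complex.abs_im_le_norm (a - b)
  simp only [clipC, Complex.sub_re, Complex.sub_im] at h h3 h4 ⊢
  linarith

lemma clipC_eq {w : ℂ} (hw : ‖w‖ ≤ 1) : clipC w = w := by
  have h3 := abs_le.1 ((Complex.abs_re_le_norm w).trans hw)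
  have h4 := abs_le.1 ((Complex.abs_im_le_norm w).trans hw)
  apply Complex.ext <;> simp [clipC, h3.1, h3.2, h4.1, h4.2]

lemma cutG_eq {w : ℂ} (hw : ‖w‖ ≤ 1) : cutG w = 1 - ‖w‖ ^ 2 := by
  rw [cutG, min_eq_right hw]

lemma cutG_abs (w : ℂ) : |cutG w| ≤ 1 := by
  have h1 : min 1 ‖w‖ ≤ 1 := min_le_left _ _
  have h2 : 0 ≤ min 1 ‖w‖ := le_min (by norm_num) (norm_nonneg _)
  rw [cutG, abs_le]
  constructor <;> nlinarith

lemma cutG_lip (a b : ℂ) : |cutG a - cutG b| ≤ 2 * ‖a - b‖ := by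
  have h2 := abs_min_sub_min_le_max (1 : ℝ) ‖b‖ 1 ‖a‖
  simp only [sub_self, abs_zero] at h2
  have h3 : |‖b‖ - ‖a‖| ≤ ‖a - b‖ := by rw [abs_sub_comm]; exact abs_norm_sub_norm_le a b
  have h4 := h2.trans (max_le (norm_nonneg _) h3)
  have h5 : min 1 ‖a‖ ≤ 1 := min_le_left _ _
  have h6 : 0 ≤ min 1 ‖a‖ := le_min (by norm_num) (norm_nonneg _)
  have h7 : min 1 ‖b‖ ≤ 1 := min_le_left _ _
  have h8 : 0 ≤ min 1 ‖b‖ := le_min (by norm_num) (norm_nonneg _)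
  have e : cutG a - cutG b = (min 1 ‖b‖ - min 1 ‖a‖) * (min 1 ‖b‖ + min 1 ‖a‖) := by
    unfold cutG; ring
  rw [e, abs_mul, mul_comm (2 : ℝ)]
  apply mul_le_mul h4 _ (abs_nonneg _) (norm_nonneg _)
  rw [abs_of_nonneg (by linarith)]; linarith

/-- Pointwise cut-off right-hand side. -/
def cutV (a b c : ℂ) : ℂ := Complex.I * (cutG a : ℂ) * (clipC b + clipC c)

lemma cutV_norm (a b c : ℂ) : ‖cutV a b c‖ ≤ 4 := by
  rw [cutV, norm_mul, norm_mul, Complex.norm_I, one_mul, Complex.norm_real, Real.norm_eq_abs]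
  have h1 := cutG_abs a
  have h2 := (norm_add_le (clipC b) (clipC c)).trans (add_le_add (clipC_norm b) (clipC_norm c))
  calc |cutG a| * ‖clipC b + clipC c‖ ≤ 1 * (2 + 2) :=
        mul_le_mul h1 h2 (norm_nonneg _) (by norm_num)
    _ = 4 := by norm_num

lemma cutV_lip (a b c a' b' c' : ℂ) {d : ℝ} (ha : ‖a - a'‖ ≤ d) (hb : ‖b - b'‖ ≤ d)
    (hc : ‖c - c'‖ ≤ d) : ‖cutV a b c - cutV a' b' c'‖ ≤ 12 * d := by
  have e : cutV a b c - cutV a' b' c' = Complex.I * ((cutG a - cutG a' : ℝ) : ℂ) * (clipC b + clipC c)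
      + Complex.I * (cutG a' : ℂ) * ((clipC b - clipC b') + (clipC c - clipC c')) := by
    unfold cutV; push_cast; ring
  have h1 := cutG_abs a'
  have h2 := (norm_add_le (clipC b) (clipC c)).trans (add_le_add (clipC_norm b) (clipC_norm c))
  have h3 := cutG_lip a a'
  have h4 := (norm_add_le (clipC b - clipC b') (clipC c - clipC c')).trans
    (add_le_add (clipC_lip b b') (clipC_lip c c'))
  have hd : 0 ≤ d := (norm_nonneg _).trans ha
  rw [e]
  refine (norm_add_le _ _).trans ?_
  rw [norm_mul, norm_mul, norm_mul, norm_mul, Complex.norm_I, one_mul, one_mul, Complex.norm_real,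
    Complex.norm_real, Real.norm_eq_abs, Real.norm_eq_abs]
  have h5 : |cutG a - cutG a'| * ‖clipC b + clipC c‖ ≤ (2 * d) * (2 + 2) :=
    mul_le_mul (by linarith) h2 (norm_nonneg _) (by linarith)
  have h6 : |cutG a'| * ‖(clipC b - clipC b') + (clipC c - clipC c')‖ ≤ 1 * (2 * d + 2 * d) :=
    mul_le_mul h1 (by linarith) (norm_nonneg _) (by norm_num)
  linarith

/-- The cut-off vector field on bounded sequences. -/
def cutF (x : BoundedContinuousFunction ℤ ℂ) : BoundedContinuousFunction ℤ ℂ :=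
  BoundedContinuousFunction.ofNormedAddCommGroupDiscrete
    (fun n => cutV (x n) (x (n - 1)) (x (n + 1))) 4 (fun _ => cutV_norm _ _ _)

lemma cutF_apply (x : BoundedContinuousFunction ℤ ℂ) (n : ℤ) :
    cutF x n = cutV (x n) (x (n - 1)) (x (n + 1)) := rfl

lemma cut_exists {t : ℝ} (ht : 0 ≤ t) (y0 : ℤ → ℂ) (h0 : ∀ n, ‖y0 n‖ < 1) :
    ∃ y : ℝ → ℤ → ℂ, (∀ n, y 0 n = y0 n) ∧ ∀ s ∈ Set.Icc 0 t, ∀ n,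
      HasDerivAt (fun u => y u n) (cutV (y s n) (y s (n - 1)) (y s (n + 1))) s := by
  let x0 : BoundedContinuousFunction ℤ ℂ :=
    BoundedContinuousFunction.ofNormedAddCommGroupDiscrete y0 1 (fun n => (h0 n).le)
  have hmem : (0 : ℝ) ∈ Set.Icc (-(t + 1)) (t + 1) := ⟨by linarith, by linarith⟩
  have hPL : IsPicardLindelof (fun _ : ℝ => cutF) (⟨0, hmem⟩ : Set.Icc (-(t + 1)) (t + 1)) x0
      (4 * (t + 1)).toNNReal 0 4 12 := by
    apply IsPicardLindelof.of_time_independent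
    · intro x _
      rw [BoundedContinuousFunction.norm_le (by positivity)]
      intro n
      exact cutV_norm _ _ _
    · apply LipschitzWith.lipschitzOnWith
      apply LipschitzWith.of_dist_le_mul
      intro x y
      rw [BoundedContinuousFunction.dist_le (by positivity)]
      intro n
      rw [dist_eq_norm, cutF_apply, cutF_apply]
      have hh : ∀ m, ‖x m - y m‖ ≤ dist x y := fun m => by
        rw [← dist_eq_norm]; exact BoundedContinuousFunction.dist_coe_le_dist m
      exact cutV_lip _ _ _ _ _ _ (hh _) (hh _) (hh _)
    · rw [Real.coe_toNNReal _ (by linarith)]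
      simp
  obtain ⟨α, hα0, hα⟩ := hPL.exists_eq_forall_mem_Icc_hasDerivWithinAt₀
  refine ⟨fun s n => α s n, fun n => ?_, fun s hs n => ?_⟩
  · have : α 0 = x0 := hα0
    show α 0 n = y0 n
    rw [this]; rfl
  · have h1 : HasDerivAt α (cutF (α s)) s :=
      (hα s ⟨by linarith [hs.1], by linarith [hs.2]⟩).hasDerivAt
        (Icc_mem_nhds (by linarith [hs.1]) (by linarith [hs.2]))
    have h2 := (BoundedContinuousFunction.evalCLM (β := ℂ) ℝ n).hasFDerivAt.comp_hasDerivAt s h1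
    exact h2

lemma cut_inv {t : ℝ} {f S : ℝ → ℂ} (h0 : ‖f 0‖ < 1)
    (hf : ∀ s ∈ Set.Icc 0 t, HasDerivAt f (Complex.I * (cutG (f s) : ℂ) * S s) s)
    (hS : ∀ s, ‖S s‖ ≤ 4) : ∀ s ∈ Set.Icc 0 t, ‖f s‖ < 1 := by
  intro s hs
  by_contra hcon
  push Not at hcon
  have hc : ContinuousOn (fun u => ‖f u‖) (Set.Icc 0 s) := fun u hu =>
    ((hf u ⟨hu.1, hu.2.trans hs.2⟩).continuousAt.norm).continuousWithinAt
  obtain ⟨c, hcm, hc1⟩ := intermediate_value_Icc hs.1 hc ⟨h0.le, hcon⟩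
  simp only at hc1
  let F : ℝ → ℝ := fun u => (1 - ‖f u‖ ^ 2) ^ 2 * Real.exp (16 * u)
  have hd : ∀ u ∈ Set.Icc 0 c, ∃ d, 0 ≤ d ∧ HasDerivAt F d u := by
    intro u hu
    have h1 := hf u ⟨hu.1, hu.2.trans (hcm.2.trans hs.2)⟩
    have h2 := h1.norm_sq
    have h3 := ((h2.const_sub 1).pow 2).mul ((((hasDerivAt_id u).const_mul 16)).exp)
    refine ⟨_, ?_, h3⟩
    set D := Complex.I * (cutG (f u) : ℂ) * S u with hD
    set v := 1 - ‖f u‖ ^ 2 with hv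
    have hDn : ‖D‖ ≤ |cutG (f u)| * 4 := by
      rw [hD, norm_mul, norm_mul, Complex.norm_I, one_mul, Complex.norm_real, Real.norm_eq_abs]
      exact mul_le_mul_of_nonneg_left (hS u) (abs_nonneg _)
    have hin : |inner ℝ (f u) D| ≤ ‖f u‖ * ‖D‖ := abs_real_inner_le_norm _ _
    have hkey : |inner ℝ (f u) D| ≤ 4 * |v| := by
      rcases le_total ‖f u‖ 1 with hle | hge
      · rw [cutG_eq hle, ← hv] at hDn
        nlinarith [norm_nonneg (f u), norm_nonneg D, abs_nonneg v]
      · have : cutG (f u) = 0 := by rw [cutG, min_eq_left hge]; norm_num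
        rw [this, abs_zero, zero_mul] at hDn
        nlinarith [norm_nonneg (f u), norm_nonneg D, abs_nonneg v]
    have h5 : v * inner ℝ (f u) D ≤ 4 * v ^ 2 := by
      calc v * inner ℝ (f u) D ≤ |v * inner ℝ (f u) D| := le_abs_self _
        _ = |v| * |inner ℝ (f u) D| := abs_mul _ _
        _ ≤ |v| * (4 * |v|) := mul_le_mul_of_nonneg_left hkey (abs_nonneg _)
        _ = 4 * v ^ 2 := by rw [← sq_abs v]; ring
    have h6 : 0 < Real.exp (16 * u) := Real.exp_pos _
    simp only [id, Pi.pow_apply]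
    have : 0 ≤ (16 * v ^ 2 - 4 * (v * inner ℝ (f u) D)) * Real.exp (16 * u) :=
      mul_nonneg (by nlinarith) h6.le
    convert this using 1
    push_cast
    ring
  have hmono : MonotoneOn F (Set.Icc 0 c) := by
    apply monotoneOn_of_deriv_nonneg (convex_Icc 0 c)
    · intro u hu
      obtain ⟨d, _, h⟩ := hd u hu
      exact h.continuousAt.continuousWithinAt
    · intro u hu
      obtain ⟨d, _, h⟩ := hd u (interior_subset hu)
      exact h.differentiableAt.differentiableWithinAt
    · intro u hu
      obtain ⟨d, h', h⟩ := hd u (interior_subset hu)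
      rw [h.deriv]; exact h'
  have hF := hmono ⟨le_rfl, hcm.1⟩ ⟨hcm.1, le_rfl⟩ hcm.1
  simp only [F, hc1] at hF
  have : 0 < 1 - ‖f 0‖ ^ 2 := by nlinarith [norm_nonneg (f 0)]
  have h7 : 0 < (1 - ‖f 0‖ ^ 2) ^ 2 * Real.exp (16 * 0) := by positivity
  norm_num at hF h7
  linarith

/-- Existence of solutions in the disc on `[0,t]`. -/
lemma AL_exists {t : ℝ} (ht : 0 ≤ t) (y0 : ℤ → ℂ) (h0 : ∀ n, ‖y0 n‖ < 1) :
    ∃ y : ℝ → ℤ → ℂ, (∀ n, y 0 n = y0 n) ∧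
      (∀ s ∈ Set.Icc 0 t, ∀ n, HasDerivAt (fun u => y u n) (ALDeriv y s n) s) ∧
      (∀ s ∈ Set.Icc 0 t, ∀ n, ‖y s n‖ < 1) := by
  obtain ⟨y, hy0, hy⟩ := cut_exists ht y0 h0
  have hb : ∀ s ∈ Set.Icc 0 t, ∀ n, ‖y s n‖ < 1 := fun s hs n =>
    cut_inv (f := fun u => y u n) (S := fun u => clipC (y u (n - 1)) + clipC (y u (n + 1)))
      (by simpa [hy0] using h0 n) (fun s hs => hy s hs n)
      (fun s => (norm_add_le _ _).trans (by linarith [clipC_norm (y s (n-1)), clipC_norm (y s (n+1))]))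
      s hs
  refine ⟨y, hy0, fun s hs n => ?_, hb⟩
  have := hy s hs n
  rw [cutV, clipC_eq (hb s hs _).le, clipC_eq (hb s hs _).le, cutG_eq (hb s hs _).le] at this
  exact this

/-- Reflection symmetry. -/
lemma AL_reflect {t : ℝ} {y : ℝ → ℤ → ℂ}
    (hy : ∀ s ∈ Set.Icc 0 t, ∀ n, HasDerivAt (fun u => y u n) (ALDeriv y s n) s) :
    ∀ s ∈ Set.Icc 0 t, ∀ n, HasDerivAt (fun u => (fun s n => y s (-n)) u n)
      (ALDeriv (fun s n => y s (-n)) s n) s := by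
  intro s hs n
  have h := hy s hs (-n)
  convert h using 1
  unfold ALDeriv
  beta_reduce
  rw [show -(n - 1) = -n + 1 by ring, show -(n + 1) = -n - 1 by ring, add_comm (y s (-n + 1))]

lemma log_sum_mono {q0 p0 : ℤ → ℂ} {η : ℝ} (hη0 : 0 < η) (hq0 : ∀ n : ℤ, ‖q0 n‖ < 1)
    (hprod : ∀ M : ℕ, η ≤ ∏ k ∈ Finset.Icc (-(M : ℤ)) (M : ℤ), (1 - ‖q0 k‖ ^ 2))
    (hp : ∀ n, p0 n = q0 n ∨ p0 n = 0) (K : ℕ) :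
    Real.log η ≤ ∑ k ∈ Finset.Icc (-(K:ℤ)) K, Real.log (1 - ‖p0 k‖^2) := by
  have hpos : ∀ n, 0 < 1 - ‖q0 n‖ ^ 2 := fun n => by nlinarith [norm_nonneg (q0 n), hq0 n]
  have h1 := Real.log_le_log hη0 (hprod K)
  rw [Real.log_prod (fun k _ => (hpos k).ne')] at h1
  refine h1.trans (Finset.sum_le_sum fun k _ => ?_)
  rcases hp k with h | h
  · rw [h]
  · rw [h, norm_zero]
    apply Real.log_le_log (hpos k)
    nlinarith [norm_nonneg (q0 k)]

lemma log_sum_reflect {p0 : ℤ → ℂ} {L : ℝ}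
    (h : ∀ K : ℕ, L ≤ ∑ k ∈ Finset.Icc (-(K:ℤ)) K, Real.log (1 - ‖p0 k‖^2)) (K : ℕ) :
    L ≤ ∑ k ∈ Finset.Icc (-(K:ℤ)) K, Real.log (1 - ‖p0 (-k)‖^2) := by
  refine (h K).trans (le_of_eq ?_)
  apply Finset.sum_nbij' (fun k => -k) (fun k => -k)
  · intro a ha; rw [Finset.mem_Icc] at *; omega
  · intro a ha; rw [Finset.mem_Icc] at *; omega
  · simp
  · simp
  · simp

theorem stmt9 (η : ℝ) (hη0 : 0 < η) (hη1 : η ≤ 1)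
    (q0 : ℤ → ℂ) (hq0 : ∀ n : ℤ, ‖q0 n‖ < 1)
    (hprod : ∀ M : ℕ, η ≤ ∏ k ∈ Finset.Icc (-(M : ℤ)) (M : ℤ), (1 - ‖q0 k‖ ^ 2))
    (N : ℕ) (q0N : ℤ → ℂ)
    (hq0N : ∀ n : ℤ, q0N n = if |n| ≤ (N : ℤ) then q0 n else 0)
    (q qN : ℝ → ℤ → ℂ)
    (hqi : ∀ n : ℤ, q 0 n = q0 n) (hqNi : ∀ n : ℤ, qN 0 n = q0N n)
    (hq : ∀ (s : ℝ) (n : ℤ), HasDerivAt (fun u => q u n) (ALDeriv q s n) s)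
    (hqN : ∀ (s : ℝ) (n : ℤ), HasDerivAt (fun u => qN u n) (ALDeriv qN s n) s)
    (hqb : ∀ (s : ℝ) (m : ℤ), ‖q s m‖ < 1)
    (hqNb : ∀ (s : ℝ) (m : ℤ), ‖qN s m‖ < 1) :
    ∀ (j : ℤ), |j| ≤ (N : ℤ) → ∀ (t : ℝ), 0 < t → ∀ (r : ℝ), 0 < r → r < 1 →
      ‖q t j - qN t j‖ ≤
        4 * Real.exp (t / r) * Cconst η r / (1 - r) * r ^ ((N : ℤ) - |j|) := by
  intro j hj t ht r hr hr1
  have hC : 0 < Cconst η r := Real.exp_pos _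
  have hqi' : q 0 = q0 := funext hqi
  have hqNi' : qN 0 = q0N := funext hqNi
  have hone : ∀ κ : ℕ, (N : ℤ) - |j| ≤ κ →
      2 * Real.exp (t / r) * Cconst η r * r ^ κ
        ≤ 2 * Real.exp (t / r) * Cconst η r * r ^ ((N : ℤ) - |j|) := by
    intro κ hκ
    refine mul_le_mul_of_nonneg_left ?_ (by positivity)
    rw [← zpow_natCast r κ]
    exact zpow_le_zpow_right_of_le_one₀ hr hr1.le hκ
  have hM : ∀ M : ℕ, N ≤ M → ‖q t j - qN t j‖ ≤
      (1 / 2 : ℝ) ^ M * (2 ^ j.natAbs * Real.exp ((2 * 2 + 4) * t)) +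
        4 * Real.exp (t / r) * Cconst η r * r ^ ((N : ℤ) - |j|) := by
    intro M hNM
    have hb1 : ∀ n, ‖(if n.natAbs ≤ M then q0 n else 0 : ℂ)‖ < 1 := by
      intro n; split_ifs
      · exact hq0 n
      · simp
    have hb2 : ∀ n, ‖(if -(M : ℤ) ≤ n ∧ n ≤ N then q0 n else 0 : ℂ)‖ < 1 := by
      intro n; split_ifs
      · exact hq0 n
      · simp
    obtain ⟨y, hy0, hy, hyb⟩ := AL_exists ht.le _ hb1
    obtain ⟨z, hz0, hz, hzb⟩ := AL_exists ht.le _ hb2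
    have Ly := log_sum_mono (p0 := y 0) hη0 hq0 hprod
      (fun n => by rw [hy0]; split_ifs <;> simp)
    have Lz := log_sum_mono (p0 := z 0) hη0 hq0 hprod
      (fun n => by rw [hz0]; split_ifs <;> simp)
    have LN := log_sum_mono (p0 := qN 0) hη0 hq0 hprod
      (fun n => by rw [hqNi, hq0N]; split_ifs <;> simp)
    have e1 := crude (q := q) (p := y) (t := t) (w := fun n => 2 ^ n.natAbs) (κ := 2)
      (A := (1 / 2 : ℝ) ^ M) (fun s _ n => hq s n) hy (fun s _ n => (hqb s n).le)
      (fun s hs n => (hyb s hs n).le) (by positivity)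
      (fun n => by
        rw [← pow_succ']
        exact pow_le_pow_right₀ (by norm_num) (by omega))
      (fun n => by
        rw [← pow_succ']
        exact pow_le_pow_right₀ (by norm_num) (by omega))
      (fun n => by
        rw [hqi, hy0]
        split_ifs with h
        · rw [sub_self, norm_zero]; positivity
        · rw [sub_zero]
          refine (hq0 n).le.trans ?_
          have h2 : (2 : ℝ) ^ M ≤ 2 ^ n.natAbs := pow_le_pow_right₀ (by norm_num) (by omega)
          calc (1 : ℝ) = (1 / 2) ^ M * 2 ^ M := by rw [← mul_pow]; norm_num
            _ ≤ _ := mul_le_mul_of_nonneg_left h2 (by positivity))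
      j t ⟨ht.le, le_rfl⟩
    have e2 := compare ht.le hy hz hyb hzb (M := M)
      (fun n hn => by rw [hy0, if_neg (by omega)])
      (fun n hn => by rw [hz0, if_neg (by omega)])
      hη0 hη1 Ly Lz (N := N)
      (fun n hn => by
        rw [hy0, hz0]
        by_cases h : n.natAbs ≤ M
        · rw [if_pos h, if_pos (by omega)]
        · rw [if_neg h, if_neg (by omega)])
      hr hr1 (j := j) (κ := (N + 1 - j).toNat) (by rw [abs_le] at hj; omega)
      (by rw [abs_le] at hj; omega)
    have e3 := compare ht.le (q := fun s n => z s (-n)) (p := fun s n => qN s (-n))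
      (AL_reflect hz) (AL_reflect fun s _ n => hqN s n)
      (fun s hs n => hzb s hs (-n)) (fun s hs n => hqNb s (-n)) (M := M)
      (fun n hn => by beta_reduce; rw [hz0, if_neg (by omega)])
      (fun n hn => by
        beta_reduce; rw [hqNi, hq0N, if_neg]
        rw [abs_le]; omega)
      hη0 hη1 (log_sum_reflect Lz) (log_sum_reflect LN) (N := N)
      (fun n hn => by
        beta_reduce
        rw [hz0, hqNi, hq0N]
        by_cases h : -n ≤ N
        · rw [if_pos (by omega), if_pos (by rw [abs_le]; omega)]
        · rw [if_neg (by omega), if_neg (by rw [abs_le]; omega)])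
      hr hr1 (j := -j) (κ := (N + 1 + j).toNat) (by rw [abs_le] at hj; omega)
      (by rw [abs_le] at hj; omega)
    simp only [neg_neg] at e3
    have f2 := e2.trans (hone _ (by have := le_abs_self j; have := neg_abs_le j; omega))
    have f3 := e3.trans (hone _ (by have := le_abs_self j; have := neg_abs_le j; omega))
    have tri : ‖q t j - qN t j‖ ≤ ‖q t j - y t j‖ + ‖y t j - z t j‖ + ‖z t j - qN t j‖ := by
      have : q t j - qN t j = (q t j - y t j) + (y t j - z t j) + (z t j - qN t j) := by ring
      rw [this]; exact norm_add₃_le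
    beta_reduce at e1
    linarith
  have hlim : Tendsto (fun M : ℕ => (1 / 2 : ℝ) ^ M * (2 ^ j.natAbs * Real.exp ((2 * 2 + 4) * t)) +
        4 * Real.exp (t / r) * Cconst η r * r ^ ((N : ℤ) - |j|)) atTop
        (nhds (0 * (2 ^ j.natAbs * Real.exp ((2 * 2 + 4) * t)) +
        4 * Real.exp (t / r) * Cconst η r * r ^ ((N : ℤ) - |j|))) :=
    ((tendsto_pow_atTop_nhds_zero_of_lt_one (by norm_num) (by norm_num)).mul_const _).add_const _
  have hfin := ge_of_tendsto hlim (eventually_atTop.2 ⟨N, fun M h => hM M h⟩)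
  rw [zero_mul, zero_add] at hfin
  refine hfin.trans (mul_le_mul_of_nonneg_right ?_ (zpow_pos hr _).le)
  rw [le_div_iff₀ (by linarith)]
  have : 0 < 4 * Real.exp (t / r) * Cconst η r := by positivity
  nlinarith
end
end

section
/- Let t₀ > 0 and let q : [0,t₀] × ℤ → ℂ be such that, for each n ∈ ℤ, the map t ↦ q(t,n) is differentiable on [0,t₀] with derivative ∂q/∂t(t,n) = i·(1 − |q(t,n)|²)·(q(t,n−1) + q(t,n+1)), and assume |q(0,n)| < 1 for every n ∈ ℤ. Then |q(t,n)| < 1 for every t ∈ [0,t₀] and every n ∈ ℤ. -/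
open Complex Metric Finset Filter

noncomputable section

theorem stmt11 (t₀ : ℝ) (ht₀ : 0 < t₀) (q : ℝ → ℤ → ℂ)
    (hq : ∀ (n : ℤ), ∀ t ∈ Set.Icc (0 : ℝ) t₀,
      HasDerivWithinAt (fun s => q s n) (ALDeriv q t n) (Set.Icc (0 : ℝ) t₀) t)
    (h0 : ∀ n : ℤ, ‖q 0 n‖ < 1) :
    ∀ t ∈ Set.Icc (0 : ℝ) t₀, ∀ n : ℤ, ‖q t n‖ < 1 := by
  intro t ht n
  have hcont : ∀ m : ℤ, ContinuousOn (fun s => q s m) (Set.Icc (0 : ℝ) t₀) :=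
    fun m s hs => (hq m s hs).continuousWithinAt
  set g : ℝ → ℝ := fun s =>
    -2 * inner ℝ (q s n) (Complex.I * (q s (n - 1) + q s (n + 1))) with hg
  have hgc : ContinuousOn g (Set.Icc (0 : ℝ) t₀) := by
    have h1 := hcont n
    have h2 := hcont (n - 1)
    have h3 := hcont (n + 1)
    exact continuousOn_const.mul
      (h1.inner (𝕜 := ℝ) (continuousOn_const.mul (h2.add h3)))
  set ge : ℝ → ℝ := Set.IccExtend ht₀.le (Set.restrict (Set.Icc 0 t₀) g) with hge
  have hgec : Continuous ge := (continuousOn_iff_continuous_restrict.1 hgc).Icc_extend'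
  have hgeq : ∀ s ∈ Set.Icc (0 : ℝ) t₀, ge s = g s := by
    intro s hs
    rw [hge, Set.IccExtend_of_mem ht₀.le _ hs]
    rfl
  have hG : ∀ s, HasDerivAt (fun u => ∫ x in (0 : ℝ)..u, ge x) (ge s) s :=
    fun s => hgec.integral_hasStrictDerivAt 0 s |>.hasDerivAt
  set F : ℝ → ℝ := fun s =>
    (1 - ‖q s n‖ ^ 2) * Real.exp (-∫ x in (0 : ℝ)..s, ge x) with hF
  have hFd : ∀ s ∈ Set.Icc (0 : ℝ) t₀, HasDerivWithinAt F 0 (Set.Icc (0 : ℝ) t₀) s := by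
    intro s hs
    have h1 := ((hq n s hs).norm_sq).const_sub 1
    have h2 := ((hG s).neg.exp).hasDerivWithinAt (s := Set.Icc (0 : ℝ) t₀)
    have h3 := h1.mul h2
    refine h3.congr_deriv ?_
    rw [hgeq s hs]
    have : ALDeriv q s n = (1 - ‖q s n‖ ^ 2 : ℝ) •
        (Complex.I * (q s (n - 1) + q s (n + 1))) := by
      rw [ALDeriv, Complex.real_smul]
      ring
    rw [this, real_inner_smul_right, hg]
    simp only [Pi.neg_apply]
    ring
  have hconst : F t = F 0 := by
    have := (convex_Icc (0 : ℝ) t₀).norm_image_sub_le_of_norm_hasDerivWithin_le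
      (C := 0) hFd (by simp) (Set.left_mem_Icc.2 ht₀.le) ht
    simpa [sub_eq_zero] using this
  have hF0 : 0 < F 0 := by
    have := h0 n
    have h' := norm_nonneg (q 0 n)
    simp only [hF, intervalIntegral.integral_same, neg_zero, Real.exp_zero, mul_one]
    nlinarith
  rw [← hconst] at hF0
  have := pos_of_mul_pos_left hF0 (Real.exp_pos _).le
  have h' := norm_nonneg (q t n)
  nlinarith
end
end
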